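/- arXiv:2111.10560 — 10 statements merged into one kernel-verified Lean document; each statement's English description precedes it below -/
import Mathlib

section
/- Let n ≥ 1, β > 0, η > 0. Let τ : [0,∞) → ℝⁿ be continuous and let π : [0,∞) → ℝⁿ be differentiable with π̇(t) = η (Q(τ(t)) − π(t)) for all t ≥ 0 and π(0) ∈ int(S). Then π(t) ∈ int(S) for all t ≥ 0. -/
noncomputable section

/-- The strategy choice distribution set `S = {x ∈ [0,1]ⁿ : 1ᵀx = 1}`. -/
def simplexS (n : ℕ) : Set (Fin n → ℝ) :=
  {x | (∀ k, 0 ≤ x k ∧ x k ≤ 1) ∧ ∑ k, x k = 1}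

/-- The relative interior `int(S) = {x ∈ (0,1)ⁿ : 1ᵀx = 1}`. -/
def simplexInt (n : ℕ) : Set (Fin n → ℝ) :=
  {x | (∀ k, 0 < x k ∧ x k < 1) ∧ ∑ k, x k = 1}

/-- The logit choice map `Q_k(τ) = exp(-βτ_k) / Σ_l exp(-βτ_l)`. -/
def logitQ (n : ℕ) (β : ℝ) (τ : Fin n → ℝ) : Fin n → ℝ :=
  fun k => Real.exp (-β * τ k) / ∑ l, Real.exp (-β * τ l)

/-- The storage function of the logit dynamics,
`S(τ, π) = η (πᵀτ + (1/β) Σ_l π_l log π_l + (1/β) log Σ_l exp(-βτ_l))`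
(with the convention `0·log 0 = 0`, which holds since `Real.log 0 = 0`). -/
def storageS (n : ℕ) (η β : ℝ) (τ p : Fin n → ℝ) : ℝ :=
  η * ((∑ k, p k * τ k) + (1 / β) * ∑ k, p k * Real.log (p k)
    + (1 / β) * Real.log (∑ l, Real.exp (-β * τ l)))

end

/-- Integrating factor: `exp (η t) g t` is nondecreasing if `g' = η (q - g)` with `q ≥ 0`. -/
theorem aux_mono (η : ℝ) (hη : 0 < η) (g q : ℝ → ℝ)
    (hg : ∀ t, 0 ≤ t → HasDerivAt g (η * (q t - g t)) t)
    (hq : ∀ t, 0 ≤ t → 0 ≤ q t) (t : ℝ) (ht : 0 ≤ t) :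
    g 0 ≤ Real.exp (η * t) * g t := by
  have hd : ∀ s, 0 ≤ s → HasDerivAt (fun s => Real.exp (η * s) * g s)
      (Real.exp (η * s) * (η * q s)) s := by
    intro s hs
    have h1 : HasDerivAt (fun s => Real.exp (η * s)) (Real.exp (η * s) * (η * 1)) s :=
      ((hasDerivAt_id s).const_mul η).exp
    exact (h1.mul (hg s hs)).congr_deriv (by ring)
  have hm : MonotoneOn (fun s => Real.exp (η * s) * g s) (Set.Ici 0) := by
    refine monotoneOn_of_deriv_nonneg (convex_Ici 0)
      (fun s hs => (hd s hs).continuousAt.continuousWithinAt)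
      (fun s hs => (hd s (interior_subset hs)).differentiableAt.differentiableWithinAt) ?_
    intro s hs
    have hs' : 0 ≤ s := interior_subset hs
    rw [(hd s hs').deriv]
    have := hq s hs'
    positivity
  have := hm (Set.mem_Ici.2 le_rfl) (Set.mem_Ici.2 ht) ht
  simpa using this

theorem aux_Q_sum (n : ℕ) (hn : 1 ≤ n) (β : ℝ) (τ : Fin n → ℝ) :
    ∑ k, logitQ n β τ k = 1 := by
  have : Nonempty (Fin n) := ⟨⟨0, hn⟩⟩
  have h : 0 < ∑ l, Real.exp (-β * τ l) :=
    Finset.sum_pos (fun _ _ => Real.exp_pos _) Finset.univ_nonempty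
  simp only [logitQ]
  rw [← Finset.sum_div, div_self h.ne']

theorem aux_Q_nonneg (n : ℕ) (β : ℝ) (τ : Fin n → ℝ) (k : Fin n) :
    0 ≤ logitQ n β τ k :=
  div_nonneg (Real.exp_pos _).le (Finset.sum_nonneg fun _ _ => (Real.exp_pos _).le)

theorem aux_Q_le (n : ℕ) (hn : 1 ≤ n) (β : ℝ) (τ : Fin n → ℝ) (k : Fin n) :
    logitQ n β τ k ≤ 1 := by
  rw [← aux_Q_sum n hn β τ]
  exact Finset.single_le_sum (fun i _ => aux_Q_nonneg n β τ i) (Finset.mem_univ k)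

/-- The logit dynamics `π̇ = η (Q(τ(t)) - π)` with continuous cost
signal `τ` and `π(0) ∈ int(S)` keeps `π(t) ∈ int(S)` for all `t ≥ 0`. -/
theorem stmt1 (n : ℕ) (hn : 1 ≤ n) (β η : ℝ) (hβ : 0 < β) (hη : 0 < η)
    (τ : ℝ → Fin n → ℝ) (hτ : ContinuousOn τ (Set.Ici (0 : ℝ)))
    (π : ℝ → Fin n → ℝ)
    (hode : ∀ t, 0 ≤ t →
      HasDerivAt π (fun k => η * (logitQ n β (τ t) k - π t k)) t)
    (hinit : π 0 ∈ simplexInt n) :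
    ∀ t, 0 ≤ t → π t ∈ simplexInt n := by
  intro t ht
  obtain ⟨h0, hs0⟩ := hinit
  have hc : ∀ k t, 0 ≤ t →
      HasDerivAt (fun s => π s k) (η * (logitQ n β (τ t) k - π t k)) t :=
    fun k t ht => (hasDerivAt_pi.1 (hode t ht)) k
  have hsum : ∀ t, 0 ≤ t →
      HasDerivAt (fun s => ∑ k, π s k) (η * (1 - ∑ k, π t k)) t := by
    intro t ht
    refine (HasDerivAt.fun_sum (u := Finset.univ) fun k _ => hc k t ht).congr_deriv ?_
    rw [← Finset.mul_sum, Finset.sum_sub_distrib, aux_Q_sum n hn]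
  refine ⟨fun k => ⟨?_, ?_⟩, ?_⟩
  · have := aux_mono η hη (fun s => π s k) (fun s => logitQ n β (τ s) k) (hc k)
      (fun s _ => aux_Q_nonneg n β _ k) t ht
    exact pos_of_mul_pos_right (lt_of_lt_of_le (h0 k).1 this) (Real.exp_pos _).le
  · have := aux_mono η hη (fun s => 1 - π s k) (fun s => 1 - logitQ n β (τ s) k)
      (fun s hs => ((hc k s hs).const_sub 1).congr_deriv (by ring))
      (fun s _ => sub_nonneg.2 (aux_Q_le n hn β _ k)) t ht
    have h2 : 0 < 1 - π 0 k := sub_pos.2 (h0 k).2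
    exact sub_pos.1 (pos_of_mul_pos_right (lt_of_lt_of_le h2 this) (Real.exp_pos _).le)
  · have h1 := aux_mono η hη (fun s => 1 - ∑ k, π s k) (fun _ => 0)
      (fun s hs => ((hsum s hs).const_sub 1).congr_deriv (by ring))
      (fun s _ => le_rfl) t ht
    have h2 := aux_mono η hη (fun s => (∑ k, π s k) - 1) (fun _ => 0)
      (fun s hs => ((hsum s hs).sub_const 1).congr_deriv (by ring))
      (fun s _ => le_rfl) t ht
    simp only [hs0, sub_self] at h1 h2
    have e := Real.exp_pos (η * t)
    have h3 := nonneg_of_mul_nonneg_right h1 e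
    have h4 := nonneg_of_mul_nonneg_right h2 e
    linarith
end

section
/- Let n ≥ 1, β > 0, η > 0. Let τ : [0,∞) → ℝⁿ and π : [0,∞) → ℝⁿ be differentiable with π(t) ∈ int(S) for all t ≥ 0 and π̇(t) = η (Q(τ(t)) − π(t)). Then for every t ≥ 0, d/dt [S(τ(t), π(t))] ≤ −τ̇(t)ᵀ π̇(t). That is, the logit dynamics is δ-passive from −τ̇ to π̇ with storage function S. -/
/-- (δ-passivity of the logit dynamics, Lemma 1.) Along any
solution of `π̇ = η (Q(τ(t)) - π)` with differentiable cost `τ` and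
`π(t) ∈ int(S)`, the storage function satisfies
`d/dt S(τ(t), π(t)) ≤ -τ̇(t)ᵀ π̇(t)` for all `t ≥ 0`. -/
theorem stmt4 (n : ℕ) (hn : 1 ≤ n) (β η : ℝ) (hβ : 0 < β) (hη : 0 < η)
    (τ π τ' π' : ℝ → Fin n → ℝ)
    (hτd : ∀ t, 0 ≤ t → HasDerivAt τ (τ' t) t)
    (hπd : ∀ t, 0 ≤ t → HasDerivAt π (π' t) t)
    (hπS : ∀ t, 0 ≤ t → π t ∈ simplexInt n)
    (hode : ∀ t, 0 ≤ t →
      π' t = fun k => η * (logitQ n β (τ t) k - π t k)) :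
    ∀ t, 0 ≤ t → ∃ s',
      HasDerivAt (fun u => storageS n η β (τ u) (π u)) s' t ∧
      s' ≤ -∑ k, τ' t k * π' t k := by
  intro t ht
  obtain ⟨hpos, hsum⟩ := hπS t ht
  have hτk : ∀ k, HasDerivAt (fun u => τ u k) (τ' t k) t := hasDerivAt_pi.1 (hτd t ht)
  have hπk : ∀ k, HasDerivAt (fun u => π u k) (π' t k) t := hasDerivAt_pi.1 (hπd t ht)
  have hπ' : ∀ k, π' t k = η * (logitQ n β (τ t) k - π t k) := fun k => congrFun (hode t ht) k
  have hne : Nonempty (Fin n) := ⟨⟨0, hn⟩⟩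
  have hZ : 0 < ∑ l, Real.exp (-β * τ t l) :=
    Finset.sum_pos (fun l _ => Real.exp_pos _) Finset.univ_nonempty
  have hQpos : ∀ k, 0 < logitQ n β (τ t) k := fun k => div_pos (Real.exp_pos _) hZ
  have hQsum : ∑ k, logitQ n β (τ t) k = 1 := by
    unfold logitQ
    rw [← Finset.sum_div, div_self hZ.ne']
  have hlogQ : ∀ k, Real.log (logitQ n β (τ t) k)
      = -β * τ t k - Real.log (∑ l, Real.exp (-β * τ t l)) := by
    intro k
    unfold logitQ
    rw [Real.log_div (Real.exp_pos _).ne' hZ.ne', Real.log_exp]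
  have hπ'sum : ∑ k, π' t k = 0 := by
    simp only [hπ']
    rw [← Finset.mul_sum, Finset.sum_sub_distrib, hQsum, hsum]
    simp
  have h1 : HasDerivAt (fun u => ∑ k, π u k * τ u k)
      (∑ k, (π' t k * τ t k + π t k * τ' t k)) t :=
    HasDerivAt.fun_sum fun k _ => (hπk k).mul (hτk k)
  have h2 : HasDerivAt (fun u => ∑ k, π u k * Real.log (π u k))
      (∑ k, (π' t k * Real.log (π t k) + π t k * (π' t k / π t k))) t :=
    HasDerivAt.fun_sum fun k _ => (hπk k).mul ((hπk k).log (hpos k).1.ne')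
  have h3 : HasDerivAt (fun u => Real.log (∑ l, Real.exp (-β * τ u l)))
      ((∑ l, Real.exp (-β * τ t l) * (-β * τ' t l)) / ∑ l, Real.exp (-β * τ t l)) t :=
    (HasDerivAt.fun_sum fun l _ => ((hτk l).const_mul (-β)).exp).log hZ.ne'
  have h4 := ((h1.add (h2.const_mul (1 / β))).add (h3.const_mul (1 / β))).const_mul η
  refine ⟨_, h4, ?_⟩
  set L := Real.log (∑ l, Real.exp (-β * τ t l)) with hL
  have e3 : 1 / β * ((∑ l, Real.exp (-β * τ t l) * (-β * τ' t l)) / ∑ l, Real.exp (-β * τ t l))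
      = ∑ k, -(logitQ n β (τ t) k * τ' t k) := by
    rw [Finset.sum_div, Finset.mul_sum]
    refine Finset.sum_congr rfl fun k _ => ?_
    unfold logitQ
    field_simp
  rw [e3, Finset.mul_sum, ← Finset.sum_add_distrib, ← Finset.sum_add_distrib, Finset.mul_sum,
    ← Finset.sum_neg_distrib]
  have hz : ∑ k, (-(τ' t k * π' t k) + η * ((1 - L) / β) * π' t k)
      = ∑ k, -(τ' t k * π' t k) := by
    rw [Finset.sum_add_distrib, ← Finset.mul_sum, hπ'sum]
    simp
  rw [← hz]
  refine Finset.sum_le_sum fun k _ => ?_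
  have hp := (hpos k).1
  have hq := hQpos k
  have hlq := hlogQ k
  have hk := hπ' k
  have hdiv : π t k * (π' t k / π t k) = π' t k := by field_simp
  rw [hdiv]
  have hτe : τ t k = -(Real.log (logitQ n β (τ t) k) + L) / β := by
    rw [hlq]; field_simp; ring
  have hmono : (logitQ n β (τ t) k - π t k)
      * (Real.log (π t k) - Real.log (logitQ n β (τ t) k)) ≤ 0 := by
    rcases le_total (π t k) (logitQ n β (τ t) k) with h | h
    · exact mul_nonpos_of_nonneg_of_nonpos (by linarith)
        (by linarith [Real.log_le_log hp h])
    · exact mul_nonpos_of_nonpos_of_nonneg (by linarith)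
        (by linarith [Real.log_le_log hq h])
  generalize logitQ n β (τ t) k = q at *
  have hfin : η * (π' t k * τ t k + π t k * τ' t k
        + 1 / β * (π' t k * Real.log (π t k) + π' t k) + -(q * τ' t k))
      - (-(τ' t k * π' t k) + η * ((1 - L) / β) * π' t k)
      = η ^ 2 / β * ((q - π t k) * (Real.log (π t k) - Real.log q)) := by
    rw [hτe, hk]
    field_simp
    ring
  have := mul_nonpos_of_nonneg_of_nonpos (by positivity : 0 ≤ η ^ 2 / β) hmono
  linarith
end

section
/- Let n ≥ 1, β > 0, τ ∈ ℝⁿ and π ∈ int(S), and set ε := min_k π_k > 0, τ^H := max_k τ_k, τ^L := min_k τ_k. Then πᵀτ + (1/β) log (Σ_{l=1}^n exp(−β τ_l)) ≥ ε (τ^H − τ^L). -/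
/-- For `π ∈ int(S)` with `ε = min_k π_k`, `τ^H = max_k τ_k`,
`τ^L = min_k τ_k`, one has `πᵀτ + (1/β) log Σ_l exp(-βτ_l) ≥ ε (τ^H - τ^L)`. -/
theorem stmt5 (n : ℕ) (hn : 1 ≤ n) (β : ℝ) (hβ : 0 < β)
    (τ p : Fin n → ℝ) (hp : p ∈ simplexInt n)
    (ε τH τL : ℝ)
    (hε : IsLeast (Set.range p) ε)
    (hτH : IsGreatest (Set.range τ) τH)
    (hτL : IsLeast (Set.range τ) τL) :
    (∑ k, p k * τ k) + (1 / β) * Real.log (∑ l, Real.exp (-β * τ l))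
      ≥ ε * (τH - τL) := by
  obtain ⟨h0, h1⟩ := hp
  obtain ⟨⟨h, rfl⟩, -⟩ := hτH
  obtain ⟨⟨m, rfl⟩, hm⟩ := hτL
  have hmin : ∀ k, τ m ≤ τ k := fun k => hm ⟨k, rfl⟩
  have hεh : ε ≤ p h := hε.2 ⟨h, rfl⟩
  have hlog : -β * τ m ≤ Real.log (∑ l, Real.exp (-β * τ l)) := by
    have hle : Real.exp (-β * τ m) ≤ ∑ l, Real.exp (-β * τ l) :=
      Finset.single_le_sum (f := fun l => Real.exp (-β * τ l))
        (fun i _ => (Real.exp_pos _).le) (Finset.mem_univ m)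
    have := Real.log_le_log (Real.exp_pos _) hle
    rwa [Real.log_exp] at this
  have hlog2 : -τ m ≤ (1 / β) * Real.log (∑ l, Real.exp (-β * τ l)) := by
    rw [one_div, inv_mul_eq_div, le_div_iff₀ hβ]
    linarith
  have hsum : p h * (τ h - τ m) ≤ ∑ k, p k * (τ k - τ m) :=
    Finset.single_le_sum (f := fun k => p k * (τ k - τ m))
      (fun i _ => mul_nonneg (h0 i).1.le (sub_nonneg.2 (hmin i))) (Finset.mem_univ h)
  have heq : ∑ k, p k * (τ k - τ m) = (∑ k, p k * τ k) - τ m := by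
    simp only [mul_sub, Finset.sum_sub_distrib, ← Finset.sum_mul, h1, one_mul]
  have hmul : ε * (τ h - τ m) ≤ p h * (τ h - τ m) :=
    mul_le_mul_of_nonneg_right hεh (sub_nonneg.2 (hmin h))
  linarith
end

section
/- Let n ≥ 1, β > 0, η > 0 and fix π ∈ int(S). For τ ∈ ℝⁿ write τ^H := max_k τ_k and τ^L := min_k τ_k. Then for every sequence (τ^{(m)})_{m∈ℕ} in ℝⁿ with τ^{(m),H} − τ^{(m),L} → ∞ as m → ∞, it holds that S(τ^{(m)}, π) → ∞. In other words, the storage function S(·, π) is radially unbounded with respect to the spread τ^H − τ^L. -/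
/-- (Radial unboundedness of the storage function, Lemma 8.)
Fix `π ∈ int(S)`. For any sequence of cost vectors whose spread
`τ^H - τ^L = max_k τ_k - min_k τ_k` diverges to `∞`, the storage function
`S(τ^{(m)}, π)` diverges to `∞`. -/
theorem stmt6 (n : ℕ) (hn : 1 ≤ n) (β η : ℝ) (hβ : 0 < β) (hη : 0 < η)
    (p : Fin n → ℝ) (hp : p ∈ simplexInt n)
    (τseq : ℕ → Fin n → ℝ) (τH τL : ℕ → ℝ)
    (hτH : ∀ m, IsGreatest (Set.range (τseq m)) (τH m))
    (hτL : ∀ m, IsLeast (Set.range (τseq m)) (τL m))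
    (hdiv : Filter.Tendsto (fun m => τH m - τL m) Filter.atTop Filter.atTop) :
    Filter.Tendsto (fun m => storageS n η β (τseq m) p)
      Filter.atTop Filter.atTop := by
  obtain ⟨hp1, hp2⟩ := hp
  haveI : Nonempty (Fin n) := ⟨⟨0, hn⟩⟩
  obtain ⟨k0, hk0⟩ := Finite.exists_min p
  have hc : 0 < p k0 := (hp1 k0).1
  set C : ℝ := (1 / β) * ∑ k, p k * Real.log (p k) with hC
  have hlim : Filter.Tendsto (fun m => η * (p k0 * (τH m - τL m) + C))
      Filter.atTop Filter.atTop :=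
    (Filter.tendsto_atTop_add_const_right _ C (hdiv.const_mul_atTop hc)).const_mul_atTop hη
  refine Filter.tendsto_atTop_mono (fun m => ?_) hlim
  obtain ⟨i, hi⟩ := (hτH m).1
  obtain ⟨j, hj⟩ := (hτL m).1
  have hL : ∀ k, τL m ≤ τseq m k := fun k => (hτL m).2 ⟨k, rfl⟩
  have h1 : -β * τL m ≤ Real.log (∑ l, Real.exp (-β * τseq m l)) := by
    have hle : Real.exp (-β * τseq m j) ≤ ∑ l, Real.exp (-β * τseq m l) :=
      Finset.single_le_sum (f := fun l => Real.exp (-β * τseq m l))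
        (fun l _ => (Real.exp_pos _).le) (Finset.mem_univ j)
    have := Real.log_le_log (Real.exp_pos _) hle
    rwa [Real.log_exp, hj] at this
  have h2 : -τL m ≤ (1 / β) * Real.log (∑ l, Real.exp (-β * τseq m l)) := by
    have := mul_le_mul_of_nonneg_left h1 (one_div_pos.mpr hβ).le
    have e : 1 / β * (-β * τL m) = -τL m := by field_simp
    linarith
  have h3 : p i * (τseq m i - τL m) ≤ ∑ k, p k * (τseq m k - τL m) :=
    Finset.single_le_sum (f := fun k => p k * (τseq m k - τL m))
      (fun k _ => mul_nonneg (hp1 k).1.le (sub_nonneg.mpr (hL k))) (Finset.mem_univ i)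
  have h4 : ∑ k, p k * (τseq m k - τL m) = (∑ k, p k * τseq m k) - τL m := by
    simp only [mul_sub, Finset.sum_sub_distrib, ← Finset.sum_mul, hp2, one_mul]
  have h5 : p k0 * (τH m - τL m) ≤ p i * (τseq m i - τL m) := by
    rw [← hi]
    exact mul_le_mul_of_nonneg_right (hk0 i) (sub_nonneg.mpr (hL i))
  unfold storageS
  apply mul_le_mul_of_nonneg_left _ hη.le
  linarith
end

section
/- Let n ≥ 1, β > 0, η > 0 and let b_k (k = 1,…,n) satisfy Assumption 1 with bias-strength bound c^H. Let T : [0,∞) → ℝⁿ and π : [0,∞) → ℝⁿ be differentiable with π(t) ∈ int(S) for all t ≥ 0, and suppose π̇(t) = η (Q(T(t) + B(π(t))) − π(t)) (Model 1: the logit dynamics with biased cost τ = T + B(π)). Then for every t ≥ 0, d/dt [S(T(t) + B(π(t)), π(t))] ≤ −Ṫ(t)ᵀ π̇(t) + c^H ‖π̇(t)‖². That is, Model 1 is δ-output-passivity-short from −Ṫ to π̇ with impact coefficient c^H. -/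
/-- (Lemma 2: δ-output-passivity-shortage of Model 1.)
Under Assumption 1 on the bias functions `b_k` (continuous on `[0,1]`,
continuously differentiable on `(0,1)`, decreasing with values in `[b^L, b^H]`
and derivative in `[-c^H, -c^L]`), along any solution of the biased logit
dynamics `π̇ = η (Q(T(t) + B(π(t))) - π)` with `π(t) ∈ int(S)`,
`d/dt S(T + B(π), π) ≤ -Ṫᵀπ̇ + c^H ‖π̇‖²` holds for all `t ≥ 0`. -/
theorem stmt7 (n : ℕ) (hn : 1 ≤ n) (β η : ℝ) (hβ : 0 < β) (hη : 0 < η)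
    (b b' : Fin n → ℝ → ℝ) (bL bH cL cH : ℝ)
    (hbLH : bL ≤ bH) (hcL : 0 < cL) (hcLH : cL ≤ cH)
    (hb_cont : ∀ k, ContinuousOn (b k) (Set.Icc 0 1))
    (hb_deriv : ∀ k, ∀ q ∈ Set.Ioo (0 : ℝ) 1, HasDerivAt (b k) (b' k q) q)
    (hb'_cont : ∀ k, ContinuousOn (b' k) (Set.Ioo 0 1))
    (hb_anti : ∀ k, StrictAntiOn (b k) (Set.Icc 0 1))
    (hb_bdd : ∀ k, ∀ q ∈ Set.Icc (0 : ℝ) 1, bL ≤ b k q ∧ b k q ≤ bH)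
    (hb'_bdd : ∀ k, ∀ q ∈ Set.Ioo (0 : ℝ) 1, -cH ≤ b' k q ∧ b' k q ≤ -cL)
    (T π T' π' : ℝ → Fin n → ℝ)
    (hTd : ∀ t, 0 ≤ t → HasDerivAt T (T' t) t)
    (hπd : ∀ t, 0 ≤ t → HasDerivAt π (π' t) t)
    (hπS : ∀ t, 0 ≤ t → π t ∈ simplexInt n)
    (hode : ∀ t, 0 ≤ t →
      π' t = fun k =>
        η * (logitQ n β (fun l => T t l + b l (π t l)) k - π t k)) :
    ∀ t, 0 ≤ t → ∃ s',
      HasDerivAt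
        (fun u => storageS n η β (fun l => T u l + b l (π u l)) (π u)) s' t ∧
      s' ≤ -(∑ k, T' t k * π' t k) + cH * ∑ k, (π' t k) ^ 2 := by
  intro t ht
  obtain ⟨hp, hsum⟩ := hπS t ht
  have hT := hasDerivAt_pi.1 (hTd t ht)
  have hP := hasDerivAt_pi.1 (hπd t ht)
  have hτ : ∀ k, HasDerivAt (fun u => T u k + b k (π u k))
      (T' t k + b' k (π t k) * π' t k) t := fun k =>
    (hT k).add ((hb_deriv k (π t k) (hp k)).comp t (hP k))
  have hode' : ∀ k, π' t k =
      η * (logitQ n β (fun l => T t l + b l (π t l)) k - π t k) := fun k =>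
    congrFun (hode t ht) k
  have : Nonempty (Fin n) := ⟨⟨0, hn⟩⟩
  have hZ : 0 < ∑ l, Real.exp (-β * (T t l + b l (π t l))) :=
    Finset.sum_pos (fun l _ => Real.exp_pos _) Finset.univ_nonempty
  have h1 := HasDerivAt.fun_sum (u := Finset.univ) (fun k _ => (hP k).mul (hτ k))
  have h2 := HasDerivAt.fun_sum (u := Finset.univ)
    (fun k _ => (hP k).mul ((hP k).log (hp k).1.ne'))
  have h3 := (HasDerivAt.fun_sum (u := Finset.univ)
    (fun k _ => ((hτ k).const_mul (-β)).exp)).log hZ.ne'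
  have h4 := (((h1.add (h2.const_mul (1 / β))).add (h3.const_mul (1 / β))).const_mul η)
  refine ⟨_, h4, ?_⟩
  set τ : Fin n → ℝ := fun l => T t l + b l (π t l) with hτdef
  set Z := ∑ l, Real.exp (-β * (T t l + b l (π t l))) with hZdef
  have hQ : ∀ k, logitQ n β τ k = Real.exp (-β * τ k) / Z := fun k => rfl
  have hQpos : ∀ k, 0 < logitQ n β τ k := fun k => by
    rw [hQ]; exact div_pos (Real.exp_pos _) hZ
  have hlogQ : ∀ k, Real.log (logitQ n β τ k) = -β * τ k - Real.log Z := fun k => by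
    rw [hQ, Real.log_div (Real.exp_pos _).ne' hZ.ne', Real.log_exp]
  have hQsum : ∑ k, logitQ n β τ k = 1 := by
    simp only [hQ]
    rw [← Finset.sum_div]
    exact div_self hZ.ne'
  have hP0 : ∑ k, π' t k = 0 := by
    simp only [hode']
    rw [← Finset.mul_sum, Finset.sum_sub_distrib, hQsum, hsum]
    ring
  have hmono : ∀ k, π' t k * (Real.log (π t k) - Real.log (logitQ n β τ k)) ≤ 0 := by
    intro k
    rw [hode' k]
    rcases le_total (π t k) (logitQ n β τ k) with h | h
    · have := Real.log_le_log (hp k).1 h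
      exact mul_nonpos_of_nonneg_of_nonpos (mul_nonneg hη.le (by linarith)) (by linarith)
    · have := Real.log_le_log (hQpos k) h
      exact mul_nonpos_of_nonpos_of_nonneg
        (mul_nonpos_of_nonneg_of_nonpos hη.le (by linarith)) (by linarith)
  have hmsum : ∑ k, π' t k * (Real.log (π t k) - Real.log (logitQ n β τ k)) ≤ 0 :=
    Finset.sum_nonpos (fun k _ => hmono k)
  have hterm : ∀ k, -(π' t k * (T' t k + b' k (π t k) * π' t k)) ≤
      -(T' t k * π' t k) + cH * (π' t k) ^ 2 := by
    intro k
    have := (hb'_bdd k (π t k) (hp k)).1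
    nlinarith [sq_nonneg (π' t k)]
  have htsum := Finset.sum_le_sum (s := Finset.univ) (fun k _ => hterm k)
  rw [Finset.sum_add_distrib, ← Finset.mul_sum, Finset.sum_neg_distrib (fun k => T' t k * π' t k)] at htsum
  refine le_trans (le_of_eq_of_le ?_ (add_le_of_nonpos_left
    (mul_nonpos_of_nonneg_of_nonpos (div_nonneg hη.le hβ.le) hmsum))) htsum
  have hzero : ∑ k, (η / β) * (1 - Real.log Z) * π' t k = 0 := by
    rw [← Finset.mul_sum, hP0, mul_zero]
  refine Eq.trans ?_ (add_zero _)
  rw [← hzero]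
  simp only [Finset.mul_sum, Finset.sum_div, ← Finset.sum_add_distrib]
  refine Finset.sum_congr rfl fun k _ => ?_
  rw [hlogQ]
  have hpk := (hp k).1.ne'
  have e := hode' k
  rw [hQ] at e
  have hτk : T t k + b k (π t k) = τ k := rfl
  simp only [hτk]
  have e2 : Real.exp (-β * τ k) = Z * (π' t k / η + π t k) := by
    rw [e]; field_simp; ring
  rw [e2]
  generalize Real.log Z = L
  generalize Real.log (π t k) = M
  have hZ' := hZ.ne'
  field_simp
  ring
end

section
/- Let n ≥ 1, β > 0, η > 0 and let w_k (k = 1,…,n) satisfy Assumption 2 with bounds w^L, w^H, v^H. Let T : [0,∞) → ℝⁿ and π : [0,∞) → ℝⁿ be differentiable with π(t) ∈ int(S) for all t ≥ 0, suppose there is a constant T_max > 0 with T_k(t) ≤ T_max for all k and all t ≥ 0, and suppose π̇(t) = η (Q(W(π(t)) T(t)) − π(t)) (Model 2: the logit dynamics with biased cost τ = W(π) T). Define the output y(t) := W(π(t)) π̇(t). Then for every t ≥ 0, d/dt [S(W(π(t)) T(t), π(t))] ≤ −Ṫ(t)ᵀ y(t) + (v^H T_max / (w^L)²) ‖y(t)‖².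 That is, Model 2 is δ-output-passivity-short from −Ṫ to y. -/
/-- (Lemma 3: δ-output-passivity-shortage of Model 2.)
Under Assumption 2 on the bias functions `w_k` (continuous on `[0,1]`,
continuously differentiable on `(0,1)`, decreasing with values in
`[w^L, w^H]`, `w^L > 0`, and derivative in `[-v^H, -v^L]`), if the actual cost
satisfies `T_k(t) ≤ T_max` for all `k, t`, then along any solution of
`π̇ = η (Q(W(π) T) - π)` with `π(t) ∈ int(S)` and output `y = W(π) π̇`,
`d/dt S(W(π) T, π) ≤ -Ṫᵀ y + (v^H T_max/(w^L)²) ‖y‖²` holds for all `t ≥ 0`. -/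
theorem stmt8 (n : ℕ) (hn : 1 ≤ n) (β η : ℝ) (hβ : 0 < β) (hη : 0 < η)
    (w w' : Fin n → ℝ → ℝ) (wL wH vL vH : ℝ)
    (hwL : 0 < wL) (hwLH : wL ≤ wH) (hvL : 0 < vL) (hvLH : vL ≤ vH)
    (hw_cont : ∀ k, ContinuousOn (w k) (Set.Icc 0 1))
    (hw_deriv : ∀ k, ∀ q ∈ Set.Ioo (0 : ℝ) 1, HasDerivAt (w k) (w' k q) q)
    (hw'_cont : ∀ k, ContinuousOn (w' k) (Set.Ioo 0 1))
    (hw_anti : ∀ k, StrictAntiOn (w k) (Set.Icc 0 1))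
    (hw_bdd : ∀ k, ∀ q ∈ Set.Icc (0 : ℝ) 1, wL ≤ w k q ∧ w k q ≤ wH)
    (hw'_bdd : ∀ k, ∀ q ∈ Set.Ioo (0 : ℝ) 1, -vH ≤ w' k q ∧ w' k q ≤ -vL)
    (Tmax : ℝ) (hTmax : 0 < Tmax)
    (T π T' π' : ℝ → Fin n → ℝ)
    (hTbdd : ∀ t, 0 ≤ t → ∀ k, T t k ≤ Tmax)
    (hTd : ∀ t, 0 ≤ t → HasDerivAt T (T' t) t)
    (hπd : ∀ t, 0 ≤ t → HasDerivAt π (π' t) t)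
    (hπS : ∀ t, 0 ≤ t → π t ∈ simplexInt n)
    (hode : ∀ t, 0 ≤ t →
      π' t = fun k =>
        η * (logitQ n β (fun l => w l (π t l) * T t l) k - π t k)) :
    ∀ t, 0 ≤ t → ∃ s',
      HasDerivAt
        (fun u => storageS n η β (fun l => w l (π u l) * T u l) (π u)) s' t ∧
      s' ≤ -(∑ k, T' t k * (w k (π t k) * π' t k))
            + (vH * Tmax / wL ^ 2) * ∑ k, (w k (π t k) * π' t k) ^ 2 := by
  intro t ht
  have hZpos : 0 < ∑ l, Real.exp (-β * (w l (π t l) * T t l)) := by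
    apply Finset.sum_pos (fun i _ => Real.exp_pos _)
    exact ⟨⟨0, by omega⟩, Finset.mem_univ _⟩
  obtain ⟨hpi, hsum⟩ := hπS t ht
  have hTk : ∀ k, HasDerivAt (fun u => T u k) (T' t k) t := hasDerivAt_pi.1 (hTd t ht)
  have hPk : ∀ k, HasDerivAt (fun u => π u k) (π' t k) t := hasDerivAt_pi.1 (hπd t ht)
  have hode' : ∀ k, π' t k = η * (logitQ n β (fun l => w l (π t l) * T t l) k - π t k) :=
    fun k => congrFun (hode t ht) k
  have hτ : ∀ k, HasDerivAt (fun u => w k (π u k) * T u k)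
      (w' k (π t k) * π' t k * T t k + w k (π t k) * T' t k) t := fun k =>
    (HasDerivAt.comp t (hw_deriv k (π t k) (hpi k)) (hPk k)).mul (hTk k)
  set d : Fin n → ℝ := fun k => w' k (π t k) * π' t k * T t k + w k (π t k) * T' t k with hd
  set Z := ∑ l, Real.exp (-β * (w l (π t l) * T t l)) with hZ
  have h1 : HasDerivAt (fun u => ∑ k, π u k * (w k (π u k) * T u k))
      (∑ k, (π' t k * (w k (π t k) * T t k) + π t k * d k)) t :=
    HasDerivAt.fun_sum fun k _ => (hPk k).mul (hτ k)
  have h2 : HasDerivAt (fun u => ∑ k, π u k * Real.log (π u k))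
      (∑ k, (π' t k * Real.log (π t k) + π t k * (π' t k / π t k))) t :=
    HasDerivAt.fun_sum fun k _ => (hPk k).mul ((hPk k).log (hpi k).1.ne')
  have h3 : HasDerivAt (fun u => Real.log (∑ k, Real.exp (-β * (w k (π u k) * T u k))))
      ((∑ k, Real.exp (-β * (w k (π t k) * T t k)) * (-β * d k)) / Z) t :=
    HasDerivAt.log (HasDerivAt.fun_sum fun k _ => ((hτ k).const_mul (-β)).exp) hZpos.ne'
  refine ⟨_, ((h1.add (h2.const_mul (1 / β))).add (h3.const_mul (1 / β))).const_mul η, ?_⟩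
  set Q : Fin n → ℝ := fun k => Real.exp (-β * (w k (π t k) * T t k)) / Z with hQ
  have hQpos : ∀ k, 0 < Q k := fun k => div_pos (Real.exp_pos _) hZpos
  have hπQ : ∀ k, π' t k = η * (Q k - π t k) := hode'
  have hQsum : ∑ k, Q k = 1 := by
    rw [hQ, ← Finset.sum_div]
    exact div_self hZpos.ne'
  have hπ0 : ∑ k, π' t k = 0 := by
    simp only [hπQ]
    rw [← Finset.mul_sum, Finset.sum_sub_distrib, hQsum, hsum]
    ring
  have hlogQ : ∀ k, w k (π t k) * T t k = -(1 / β) * (Real.log (Q k) + Real.log Z) := by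
    intro k
    rw [hQ]
    simp only
    rw [Real.log_div (Real.exp_pos _).ne' hZpos.ne', Real.log_exp]
    field_simp
    ring
  have e3 : (∑ k, Real.exp (-β * (w k (π t k) * T t k)) * (-β * d k)) / Z
      = ∑ k, Q k * (-β * d k) := by
    rw [Finset.sum_div]
    refine Finset.sum_congr rfl fun k _ => ?_
    rw [hQ]
    ring
  have key : η * ((∑ k, (π' t k * (w k (π t k) * T t k) + π t k * d k))
      + 1 / β * (∑ k, (π' t k * Real.log (π t k) + π t k * (π' t k / π t k)))
      + 1 / β * ((∑ k, Real.exp (-β * (w k (π t k) * T t k)) * (-β * d k)) / Z))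
      = ∑ k, (η ^ 2 / β * ((Q k - π t k) * (Real.log (π t k) - Real.log (Q k))) - d k * π' t k)
        + η / β * (1 - Real.log Z) * ∑ k, π' t k := by
    rw [e3, Finset.mul_sum, Finset.mul_sum, Finset.mul_sum, ← Finset.sum_add_distrib,
      ← Finset.sum_add_distrib, ← Finset.sum_add_distrib, Finset.mul_sum]
    refine Finset.sum_congr rfl fun k _ => ?_
    rw [mul_div_cancel₀ _ (hpi k).1.ne', hlogQ k, hπQ k]
    field_simp
    ring
  refine (le_of_eq key).trans ?_
  rw [hπ0, mul_zero, add_zero, Finset.mul_sum, ← Finset.sum_neg_distrib,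
    ← Finset.sum_add_distrib]
  refine Finset.sum_le_sum fun k _ => ?_
  have hent : (Q k - π t k) * (Real.log (π t k) - Real.log (Q k)) ≤ 0 := by
    rcases le_total (Q k) (π t k) with h | h
    · exact mul_nonpos_of_nonpos_of_nonneg (by linarith)
        (sub_nonneg.2 (Real.log_le_log (hQpos k) h))
    · exact mul_nonpos_of_nonneg_of_nonpos (by linarith)
        (sub_nonpos.2 (Real.log_le_log (hpi k).1 h))
  have hent' := mul_nonpos_of_nonneg_of_nonpos (by positivity : 0 ≤ η ^ 2 / β) hent
  obtain ⟨hv1, hv2⟩ := hw'_bdd k _ (hpi k)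
  have hT := hTbdd t ht k
  have hvH : 0 < vH := by linarith
  have hwT : -(w' k (π t k) * T t k) ≤ vH * Tmax := by
    have a1 : -w' k (π t k) * T t k ≤ -w' k (π t k) * Tmax :=
      mul_le_mul_of_nonneg_left hT (by linarith)
    have a2 : -w' k (π t k) * Tmax ≤ vH * Tmax :=
      mul_le_mul_of_nonneg_right (by linarith) hTmax.le
    linarith
  have hb : wL ≤ w k (π t k) := (hw_bdd k _ ⟨(hpi k).1.le, (hpi k).2.le⟩).1
  have hsq : wL ^ 2 ≤ w k (π t k) ^ 2 := pow_le_pow_left₀ hwL.le hb 2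
  have b1 : -(w' k (π t k) * T t k) * π' t k ^ 2 ≤ vH * Tmax * π' t k ^ 2 :=
    mul_le_mul_of_nonneg_right hwT (sq_nonneg _)
  have b2 : vH * Tmax * π' t k ^ 2 ≤ vH * Tmax / wL ^ 2 * (w k (π t k) * π' t k) ^ 2 := by
    have : vH * Tmax * π' t k ^ 2 = vH * Tmax / wL ^ 2 * (wL ^ 2 * π' t k ^ 2) := by
      field_simp
    rw [this, mul_pow]
    gcongr
  have hdk : d k * π' t k = w' k (π t k) * T t k * π' t k ^ 2
      + T' t k * (w k (π t k) * π' t k) := by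
    rw [hd]
    ring
  rw [hdk]
  linarith
end

section
/- Let n ≥ 2, β > 0, η > 0, ρ > 0, κ > 0, π* ∈ int(S), and let b_k (k = 1,…,n) satisfy Assumption 1 with bounds b^L ≤ b_k ≤ b^H. Let π : [0,∞) → ℝⁿ satisfy π(t) ∈ int(S) and min_k π_k(t) ≥ ε for all t ≥ 0, for some ε > 0. Let μ : [0,∞) → ℝⁿ be differentiable with μ̇(t) = ρ (π(t) − π*) and set T(t) := μ(t) + κ (π(t) − π*). If ‖T(t)‖ → ∞ as t → ∞, then S(T(t) + B(π(t)), π(t)) → ∞ as t → ∞. -/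
/-- (Lemma 5.) Along the PI mechanism `μ̇ = ρ(π - π*)`,
`T = μ + κ(π - π*)`, with `π(t) ∈ int(S)`, `min_k π_k(t) ≥ ε > 0` and bias
functions `b_k` satisfying Assumption 1, if `‖T(t)‖ → ∞` (Euclidean norm) as
`t → ∞` then `S(T(t) + B(π(t)), π(t)) → ∞`. -/
theorem stmt11 (n : ℕ) (hn : 2 ≤ n) (β η ρ κ : ℝ)
    (hβ : 0 < β) (hη : 0 < η) (hρ : 0 < ρ) (hκ : 0 < κ)
    (πs : Fin n → ℝ) (hπs : πs ∈ simplexInt n)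
    (b b' : Fin n → ℝ → ℝ) (bL bH cL cH : ℝ)
    (hbLH : bL ≤ bH) (hcL : 0 < cL) (hcLH : cL ≤ cH)
    (hb_cont : ∀ k, ContinuousOn (b k) (Set.Icc 0 1))
    (hb_deriv : ∀ k, ∀ q ∈ Set.Ioo (0 : ℝ) 1, HasDerivAt (b k) (b' k q) q)
    (hb'_cont : ∀ k, ContinuousOn (b' k) (Set.Ioo 0 1))
    (hb_anti : ∀ k, StrictAntiOn (b k) (Set.Icc 0 1))
    (hb_bdd : ∀ k, ∀ q ∈ Set.Icc (0 : ℝ) 1, bL ≤ b k q ∧ b k q ≤ bH)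
    (hb'_bdd : ∀ k, ∀ q ∈ Set.Ioo (0 : ℝ) 1, -cH ≤ b' k q ∧ b' k q ≤ -cL)
    (ε : ℝ) (hε : 0 < ε)
    (π μ : ℝ → Fin n → ℝ)
    (hπS : ∀ t, 0 ≤ t → π t ∈ simplexInt n)
    (hπε : ∀ t, 0 ≤ t → ∀ k, ε ≤ π t k)
    (hμd : ∀ t, 0 ≤ t → HasDerivAt μ (fun k => ρ * (π t k - πs k)) t)
    (T : ℝ → Fin n → ℝ)
    (hT : ∀ t, ∀ k, T t k = μ t k + κ * (π t k - πs k))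
    (hTdiv : Filter.Tendsto (fun t => Real.sqrt (∑ k, (T t k) ^ 2))
      Filter.atTop Filter.atTop) :
    Filter.Tendsto
      (fun t => storageS n η β (fun l => T t l + b l (π t l)) (π t))
      Filter.atTop Filter.atTop := by
  obtain ⟨C, hC⟩ : ∃ C, C = ∑ k, μ 0 k := ⟨_, rfl⟩
  have hμsum : ∀ t, 0 ≤ t → ∑ k, μ t k = C := by
    intro t ht
    have hd : ∀ s, 0 ≤ s → HasDerivAt (fun s => ∑ k, μ s k) 0 s := by
      intro s hs
      have h1 := hasDerivAt_pi.1 (hμd s hs)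
      have h2 := HasDerivAt.fun_sum (u := Finset.univ) (fun k _ => h1 k)
      have h3 : ∑ k, ρ * (π s k - πs k) = 0 := by
        rw [← Finset.mul_sum, Finset.sum_sub_distrib, (hπS s hs).2, hπs.2]; simp
      rw [h3] at h2
      exact h2
    have := constant_of_has_deriv_right_zero (f := fun s => ∑ k, μ s k) (a := 0) (b := t)
      (fun s hs => (hd s hs.1).continuousAt.continuousWithinAt)
      (fun s hs => (hd s hs.1).hasDerivWithinAt) t ⟨ht, le_refl t⟩
    rw [hC]; exact this
  have hTsum : ∀ t, 0 ≤ t → ∑ k, T t k = C := by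
    intro t ht
    simp only [hT]
    rw [Finset.sum_add_distrib, hμsum t ht, ← Finset.mul_sum, Finset.sum_sub_distrib,
      (hπS t ht).2, hπs.2]; simp
  have hne : Nonempty (Fin n) := ⟨⟨0, by omega⟩⟩
  have key : ∀ t, 0 ≤ t →
      η * (ε * ((Real.sqrt (∑ k, (T t k) ^ 2) - |C|) / 2) - (bH - bL) - (1 / β) * n) ≤
        storageS n η β (fun l => T t l + b l (π t l)) (π t) := by
    intro t ht
    obtain ⟨j, hj⟩ := Finite.exists_min (T t)
    have hp := hπS t ht
    have hsumD : ∑ k, (T t k - T t j) = C - n * T t j := by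
      rw [Finset.sum_sub_distrib, hTsum t ht]; simp
    have hnorm : Real.sqrt (∑ k, (T t k) ^ 2) ≤ ∑ k, |T t k| := by
      apply Real.sqrt_le_iff.2
      refine ⟨Finset.sum_nonneg fun k _ => abs_nonneg _, ?_⟩
      have := Finset.sum_sq_le_sq_sum_of_nonneg (s := Finset.univ) (f := fun k => |T t k|)
        (fun k _ => abs_nonneg _)
      simpa only [sq_abs] using this
    have habs : ∑ k, |T t k| ≤ ∑ k, (T t k - T t j) + n * |T t j| := by
      have : ∑ k, |T t k| ≤ ∑ k, ((T t k - T t j) + |T t j|) := by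
        apply Finset.sum_le_sum
        intro k _
        have h1 := hj k
        have h2 := neg_abs_le (T t j)
        have h3 := le_abs_self (T t j)
        rw [abs_le]; constructor <;> linarith
      rw [Finset.sum_add_distrib] at this
      simpa using this
    have hnT : n * |T t j| ≤ |C| + ∑ k, (T t k - T t j) := by
      have hD : 0 ≤ ∑ k, (T t k - T t j) :=
        Finset.sum_nonneg fun k _ => sub_nonneg.2 (hj k)
      have h1 : (n : ℝ) * |T t j| = |(n : ℝ) * T t j| := by
        rw [abs_mul, Nat.abs_cast]
      rw [h1]
      have h2 := neg_abs_le C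
      have h3 := le_abs_self C
      rw [abs_le]; constructor <;> linarith
    have hent : -(n : ℝ) ≤ ∑ k, π t k * Real.log (π t k) := by
      have : ∑ _k : Fin n, (-1 : ℝ) ≤ ∑ k, π t k * Real.log (π t k) := by
        apply Finset.sum_le_sum
        intro k _
        have h0 := (hp.1 k).1
        have h1 := Real.one_sub_inv_le_log_of_pos h0
        have h2 := mul_le_mul_of_nonneg_left h1 h0.le
        have h3 : π t k * (1 - (π t k)⁻¹) = π t k - 1 := by field_simp
        linarith
      simpa using this
    have hlog : -(T t j + b j (π t j)) ≤
        (1 / β) * Real.log (∑ l, Real.exp (-β * (T t l + b l (π t l)))) := by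
      have h1 : Real.exp (-β * (T t j + b j (π t j))) ≤
          ∑ l, Real.exp (-β * (T t l + b l (π t l))) :=
        Finset.single_le_sum (f := fun l => Real.exp (-β * (T t l + b l (π t l))))
          (fun l _ => (Real.exp_pos _).le) (Finset.mem_univ j)
      have h2 := Real.log_le_log (Real.exp_pos _) h1
      rw [Real.log_exp] at h2
      have h3 := mul_le_mul_of_nonneg_left h2 (one_div_pos.2 hβ).le
      have h4 : (1 / β) * (-β * (T t j + b j (π t j))) = -(T t j + b j (π t j)) := by
        field_simp
      linarith
    have hlin : ε * ∑ k, (T t k - T t j) - (bH - bL) ≤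
        (∑ k, π t k * (T t k + b k (π t k))) - (T t j + b j (π t j)) := by
      have h1 : (∑ k, π t k * (T t k + b k (π t k))) - (T t j + b j (π t j)) =
          ∑ k, π t k * ((T t k - T t j) + (b k (π t k) - b j (π t j))) := by
        calc _ = (∑ k, π t k * (T t k + b k (π t k))) -
              (∑ k, π t k) * (T t j + b j (π t j)) := by rw [hp.2, one_mul]
          _ = _ := by
            rw [Finset.sum_mul, ← Finset.sum_sub_distrib]
            exact Finset.sum_congr rfl fun k _ => by ring
      have h2 : ε * ∑ k, (T t k - T t j) - (bH - bL) =
          ∑ k, (ε * (T t k - T t j) - π t k * (bH - bL)) := by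
        rw [Finset.mul_sum, Finset.sum_sub_distrib (fun k => ε * (T t k - T t j)), ← Finset.sum_mul, hp.2, one_mul]
      rw [h1, h2]
      apply Finset.sum_le_sum
      intro k _
      have h0 := hp.1 k
      have h0j := hp.1 j
      have e1 := mul_le_mul_of_nonneg_right (hπε t ht k) (sub_nonneg.2 (hj k))
      have e2 := hb_bdd k (π t k) ⟨h0.1.le, h0.2.le⟩
      have e3 := hb_bdd j (π t j) ⟨h0j.1.le, h0j.2.le⟩
      have e4 : -(bH - bL) ≤ b k (π t k) - b j (π t j) := by linarith
      have e5 := mul_le_mul_of_nonneg_left e4 h0.1.le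
      linarith
    unfold storageS
    apply mul_le_mul_of_nonneg_left _ hη.le
    have f1 : (Real.sqrt (∑ k, (T t k) ^ 2) - |C|) / 2 ≤ ∑ k, (T t k - T t j) := by linarith
    have f2 := mul_le_mul_of_nonneg_left f1 hε.le
    have f3 := mul_le_mul_of_nonneg_left hent (one_div_pos.2 hβ).le
    linarith
  refine Filter.tendsto_atTop_mono' Filter.atTop
    ((Filter.eventually_ge_atTop 0).mono key) ?_
  apply Filter.Tendsto.const_mul_atTop hη
  simp only [sub_eq_add_neg]
  apply Filter.tendsto_atTop_add_const_right
  apply Filter.tendsto_atTop_add_const_right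
  apply Filter.Tendsto.const_mul_atTop hε
  apply Filter.Tendsto.atTop_div_const two_pos
  exact Filter.tendsto_atTop_add_const_right _ _ hTdiv
end

section
/- Let n ≥ 1, β > 0, η > 0, ρ > 0, κ > 0, π* ∈ int(S), and let b_k (k = 1,…,n) satisfy Assumption 1 with bias-strength bound c^H. Let π, μ : [0,∞) → ℝⁿ be differentiable with π(0) ∈ int(S), and suppose for all t ≥ 0: T(t) = μ(t) + κ (π(t) − π*), μ̇(t) = ρ (π(t) − π*), and π̇(t) = η (Q(T(t) + B(π(t))) − π(t)) (the closed-loop system of Model 1 with the PI mechanism). If κ > c^H, then π(t) → π* as t → ∞. -/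
open Filter Topology

lemma aux_decay (η : ℝ) (f g : ℝ → ℝ)
    (hf : ∀ t, 0 ≤ t → HasDerivAt f (η * (g t - f t)) t) (hη : 0 < η)
    (hg : ∀ t, 0 ≤ t → 0 ≤ g t) (t : ℝ) (ht : 0 ≤ t) :
    f 0 ≤ Real.exp (η * t) * f t := by
  have hd : ∀ s, 0 ≤ s → HasDerivAt (fun s => Real.exp (η * s) * f s)
      (Real.exp (η * s) * (η * g s)) s := by
    intro s hs
    have h1 : HasDerivAt (fun s : ℝ => η * s) η s := by
      simpa using (hasDerivAt_id s).const_mul η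
    have h2 := h1.exp.mul (hf s hs)
    refine h2.congr_deriv ?_
    ring
  have hm : MonotoneOn (fun s => Real.exp (η * s) * f s) (Set.Ici 0) := by
    apply monotoneOn_of_deriv_nonneg (convex_Ici 0)
    · intro s hs
      exact (hd s hs).continuousAt.continuousWithinAt
    · intro s hs
      rw [interior_Ici] at hs
      exact (hd s hs.le).differentiableAt.differentiableWithinAt
    · intro s hs
      rw [interior_Ici] at hs
      rw [(hd s hs.le).deriv]
      have := hg s hs.le
      positivity
  have := hm (Set.mem_Ici.2 le_rfl) (Set.mem_Ici.2 ht) ht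
  simpa using this

/-- Increment bound from a derivative bound, on the half line. -/
lemma aux_incr (f f' : ℝ → ℝ) (hf : ∀ t, 0 ≤ t → HasDerivAt f (f' t) t)
    (C a c : ℝ) (ha : 0 ≤ a) (hac : a ≤ c) (hC : ∀ s ∈ Set.Icc a c, |f' s| ≤ C) :
    |f c - f a| ≤ C * (c - a) := by
  have := norm_image_sub_le_of_norm_deriv_le_segment' (f := f) (f' := f') (a := a) (b := c) (C := C)
    (fun x hx => (hf x (ha.trans hx.1)).hasDerivWithinAt)
    (fun x hx => hC x ⟨hx.1, hx.2.le⟩) c ⟨hac, le_rfl⟩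
  simpa using this

lemma aux_decr (f f' : ℝ → ℝ) (hf : ∀ t, 0 ≤ t → HasDerivAt f (f' t) t)
    (C a c : ℝ) (ha : 0 ≤ a) (hac : a ≤ c) (hC : ∀ s ∈ Set.Icc a c, f' s ≤ C) :
    f c - f a ≤ C * (c - a) := by
  apply (convex_Icc a c).image_sub_le_mul_sub_of_deriv_le (f := f)
  · intro s hs
    exact (hf s (ha.trans hs.1)).continuousAt.continuousWithinAt
  · intro s hs
    have hs := interior_subset hs
    exact (hf s (ha.trans hs.1)).differentiableAt.differentiableWithinAt
  · intro s hs
    have hs := interior_subset hs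
    rw [(hf s (ha.trans hs.1)).deriv]
    exact hC s hs
  · exact ⟨le_rfl, hac⟩
  · exact ⟨hac, le_rfl⟩
  · exact hac

/-- Window lemma. -/
lemma aux_window (f f' : ℝ → ℝ) (hf : ∀ t, 0 ≤ t → HasDerivAt f (f' t) t)
    (h0 : Tendsto f' atTop (𝓝 0)) :
    Tendsto (fun t => f (t + 1) - f t) atTop (𝓝 0) := by
  rw [Metric.tendsto_atTop] at h0 ⊢
  intro ε hε
  obtain ⟨N, hN⟩ := h0 (ε / 2) (by positivity)
  refine ⟨max N 0, fun t ht => ?_⟩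
  have h1 : N ≤ t := (le_max_left _ _).trans ht
  have h2 : 0 ≤ t := (le_max_right _ _).trans ht
  have := aux_incr f f' hf (ε / 2) t (t + 1) h2 (by linarith) (by
    intro s hs
    have := hN s (h1.trans hs.1)
    rw [Real.dist_eq, sub_zero] at this
    exact this.le)
  rw [Real.dist_eq, sub_zero]
  linarith

/-- Second order window lemma: the unit increment approximates a slowly varying derivative. -/
lemma aux_window2 (f f' f'' : ℝ → ℝ) (hf : ∀ t, 0 ≤ t → HasDerivAt f (f' t) t)
    (hf' : ∀ t, 0 ≤ t → HasDerivAt f' (f'' t) t)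
    (h0 : Tendsto f'' atTop (𝓝 0)) :
    Tendsto (fun t => f (t + 1) - f t - f' t) atTop (𝓝 0) := by
  rw [Metric.tendsto_atTop] at h0 ⊢
  intro ε hε
  obtain ⟨N, hN⟩ := h0 (ε / 2) (by positivity)
  refine ⟨max N 0, fun t ht => ?_⟩
  have h1 : N ≤ t := (le_max_left _ _).trans ht
  have h2 : 0 ≤ t := (le_max_right _ _).trans ht
  have key : ∀ s ∈ Set.Icc t (t + 1), |f' s - f' t| ≤ ε / 2 := by
    intro s hs
    have := aux_incr f' f'' hf' (ε / 2) t s h2 hs.1 (by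
      intro r hr
      have := hN r (h1.trans hr.1)
      rw [Real.dist_eq, sub_zero] at this
      exact this.le)
    nlinarith [hs.2]
  have := aux_incr (fun s => f s - f' t * s) (fun s => f' s - f' t) (by
    intro s hs
    have := (hf s hs).sub ((hasDerivAt_id s).const_mul (f' t))
    exact this.congr_deriv (by simp)) (ε / 2) t (t + 1) h2 (by linarith) key
  rw [Real.dist_eq, sub_zero]
  have e : f (t + 1) - f' t * (t + 1) - (f t - f' t * t) = f (t + 1) - f t - f' t := by ring
  simp only [e] at this
  linarith

/-- A Barbalat type lemma. -/
lemma aux_barbalat (V V' f f' : ℝ → ℝ) (c L : ℝ) (hc : 0 < c) (hL : 0 < L)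
    (hV : ∀ t, 0 ≤ t → HasDerivAt V (V' t) t)
    (hV0 : ∀ t, 0 ≤ t → 0 ≤ V t)
    (hf : ∀ t, 0 ≤ t → HasDerivAt f (f' t) t)
    (hf' : ∀ t, 0 ≤ t → |f' t| ≤ L)
    (hVf : ∀ t, 0 ≤ t → V' t ≤ -c * (f t) ^ 2) :
    Tendsto f atTop (𝓝 0) := by
  by_contra hcon
  rw [Metric.tendsto_atTop] at hcon
  push Not at hcon
  obtain ⟨ε, hε, hN⟩ := hcon
  have hanti : ∀ a d, 0 ≤ a → a ≤ d → V d ≤ V a := by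
    intro a d ha had
    have := aux_decr V V' hV 0 a d ha had (by
      intro s hs
      have := hVf s (ha.trans hs.1)
      nlinarith [sq_nonneg (f s)])
    linarith
  set δ := ε / (2 * L) with hδ
  have hδ0 : 0 < δ := by positivity
  set γ := c * (ε / 2) ^ 2 * δ with hγ
  have hγ0 : 0 < γ := by positivity
  have hstep : ∀ a, 0 ≤ a → ∃ d, a ≤ d ∧ V d ≤ V a - γ := by
    intro a ha
    obtain ⟨t, hat, ht⟩ := hN a
    rw [Real.dist_eq, sub_zero] at ht
    have ht0 := ha.trans hat
    refine ⟨t + δ, by linarith, ?_⟩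
    have h1 := aux_decr V V' hV (-(c * (ε / 2) ^ 2)) t (t + δ) ht0 (by linarith) (by
      intro s hs
      have h2 := aux_incr f f' hf L t s ht0 hs.1 (fun r hr => hf' r (ht0.trans hr.1))
      have h3 : L * (s - t) ≤ ε / 2 := by
        have : L * (s - t) ≤ L * δ := by
          apply mul_le_mul_of_nonneg_left _ hL.le
          linarith [hs.2]
        have e : L * δ = ε / 2 := by rw [hδ]; field_simp
        linarith
      have h4 : ε / 2 ≤ |f s| := by
        have := abs_sub_abs_le_abs_sub (f t) (f s)
        rw [abs_sub_comm] at this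
        linarith
      have h5 : (ε / 2) ^ 2 ≤ (f s) ^ 2 := by
        rw [← sq_abs (f s)]
        exact pow_le_pow_left₀ (by positivity) h4 2
      have := hVf s (ht0.trans hs.1)
      nlinarith)
    have := hanti a t ha hat
    have e : -(c * (ε / 2) ^ 2) * (t + δ - t) = -γ := by rw [hγ]; ring
    rw [e] at h1
    linarith
  have hiter : ∀ m : ℕ, ∃ d, 0 ≤ d ∧ V d ≤ V 0 - m * γ := by
    intro m
    induction m with
    | zero => exact ⟨0, le_rfl, by simp⟩
    | succ m ih =>
      obtain ⟨d, hd, hVd⟩ := ih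
      obtain ⟨e, he, hVe⟩ := hstep d hd
      refine ⟨e, hd.trans he, ?_⟩
      push_cast
      linarith
  obtain ⟨m, hm⟩ := exists_nat_gt (V 0 / γ)
  obtain ⟨d, hd, hVd⟩ := hiter m
  have := hV0 d hd
  rw [div_lt_iff₀ hγ0] at hm
  linarith

/-- Upper trapping. -/
lemma aux_trap (f f' : ℝ → ℝ) (hf : ∀ t, 0 ≤ t → HasDerivAt f (f' t) t)
    (M t0 : ℝ) (ht0 : 0 ≤ t0) (h : ∀ t, t0 ≤ t → M ≤ f t → f' t < 0) :
    ∃ K, ∀ t, t0 ≤ t → f t ≤ K := by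
  refine ⟨max M (f t0), fun t ht => ?_⟩
  refine image_le_of_deriv_right_lt_deriv_boundary' (f := f) (f' := f') (a := t0) (b := t)
    (B := fun _ => max M (f t0)) (B' := fun _ => 0) ?_ ?_ ?_ ?_ ?_ ?_ ⟨ht, le_rfl⟩
  · intro s hs
    exact (hf s (ht0.trans hs.1)).continuousAt.continuousWithinAt
  · intro s hs
    exact (hf s (ht0.trans hs.1)).hasDerivWithinAt
  · exact le_max_right _ _
  · exact continuousOn_const
  · intro s hs
    exact (hasDerivAt_const _ _).hasDerivWithinAt
  · intro s hs hfs
    apply h s hs.1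
    rw [hfs]
    exact le_max_left _ _

lemma logitQ_pos (n : ℕ) [Nonempty (Fin n)] (β : ℝ) (τ : Fin n → ℝ) (k : Fin n) :
    0 < logitQ n β τ k := by
  unfold logitQ
  have : 0 < ∑ l, Real.exp (-β * τ l) :=
    Finset.sum_pos (fun l _ => Real.exp_pos _) Finset.univ_nonempty
  have := Real.exp_pos (-β * τ k)
  positivity

lemma logitQ_sum (n : ℕ) [Nonempty (Fin n)] (β : ℝ) (τ : Fin n → ℝ) :
    ∑ k, logitQ n β τ k = 1 := by
  unfold logitQ
  have : 0 < ∑ l, Real.exp (-β * τ l) :=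
    Finset.sum_pos (fun l _ => Real.exp_pos _) Finset.univ_nonempty
  rw [← Finset.sum_div, div_self this.ne']

lemma logitQ_le_one (n : ℕ) [Nonempty (Fin n)] (β : ℝ) (τ : Fin n → ℝ) (k : Fin n) :
    logitQ n β τ k ≤ 1 := by
  rw [← logitQ_sum n β τ]
  exact Finset.single_le_sum (f := fun k => logitQ n β τ k)
    (fun l _ => (logitQ_pos n β τ l).le) (Finset.mem_univ k)

lemma logitQ_log (n : ℕ) [Nonempty (Fin n)] (β : ℝ) (τ : Fin n → ℝ) (k : Fin n) :
    Real.log (logitQ n β τ k) = -β * τ k - Real.log (∑ l, Real.exp (-β * τ l)) := by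
  unfold logitQ
  have : 0 < ∑ l, Real.exp (-β * τ l) :=
    Finset.sum_pos (fun l _ => Real.exp_pos _) Finset.univ_nonempty
  rw [Real.log_div (Real.exp_pos _).ne' this.ne', Real.log_exp]

lemma logitQ_le_exp (n : ℕ) [Nonempty (Fin n)] (β : ℝ) (τ : Fin n → ℝ) (k j : Fin n) :
    logitQ n β τ k ≤ Real.exp (-β * (τ k - τ j)) := by
  unfold logitQ
  have h1 : Real.exp (-β * τ j) ≤ ∑ l, Real.exp (-β * τ l) :=
    Finset.single_le_sum (f := fun l => Real.exp (-β * τ l))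
    (fun l _ => (Real.exp_pos _).le) (Finset.mem_univ j)
  calc _ ≤ Real.exp (-β * τ k) / Real.exp (-β * τ j) := by
        gcongr
    _ = _ := by rw [← Real.exp_sub]; congr 1; ring

lemma logitQ_lower (n : ℕ) [Nonempty (Fin n)] (β K : ℝ) (hβ : 0 < β) (τ : Fin n → ℝ)
    (h : ∀ k, |τ k| ≤ K) (k : Fin n) :
    Real.exp (-β * K) / (n * Real.exp (β * K)) ≤ logitQ n β τ k := by
  unfold logitQ
  have hZ : 0 < ∑ l, Real.exp (-β * τ l) :=
    Finset.sum_pos (fun l _ => Real.exp_pos _) Finset.univ_nonempty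
  apply div_le_div₀ (Real.exp_pos _).le _ hZ _
  · apply Real.exp_le_exp.2
    nlinarith [(abs_le.1 (h k)).2]
  · calc _ ≤ ∑ l : Fin n, Real.exp (β * K) := by
          apply Finset.sum_le_sum
          intro l _
          apply Real.exp_le_exp.2
          nlinarith [(abs_le.1 (h l)).1]
      _ = _ := by simp

lemma logitQ_hasDerivAt (n : ℕ) [Nonempty (Fin n)] (β : ℝ) (τ : ℝ → Fin n → ℝ) (dτ : Fin n → ℝ)
    (t : ℝ) (h : ∀ k, HasDerivAt (fun s => τ s k) (dτ k) t) (k : Fin n) :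
    HasDerivAt (fun s => logitQ n β (τ s) k)
      (β * logitQ n β (τ t) k * (∑ l, logitQ n β (τ t) l * dτ l - dτ k)) t := by
  have hZ : 0 < ∑ l, Real.exp (-β * τ t l) :=
    Finset.sum_pos (fun l _ => Real.exp_pos _) Finset.univ_nonempty
  have he : ∀ l, HasDerivAt (fun s => Real.exp (-β * τ s l))
      (Real.exp (-β * τ t l) * (-β * dτ l)) t := fun l => ((h l).const_mul (-β)).exp
  have hs : HasDerivAt (fun s => ∑ l, Real.exp (-β * τ s l))
      (∑ l, Real.exp (-β * τ t l) * (-β * dτ l)) t :=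
    HasDerivAt.fun_sum (fun l _ => he l)
  have := (he k).fun_div hs hZ.ne'
  unfold logitQ
  refine this.congr_deriv ?_
  have e1 : ∑ l, Real.exp (-β * τ t l) * (-β * dτ l)
      = -β * ∑ l, Real.exp (-β * τ t l) * dτ l := by
    rw [Finset.mul_sum]; exact Finset.sum_congr rfl (fun l _ => by ring)
  have e2 : ∑ l, Real.exp (-β * τ t l) / (∑ l, Real.exp (-β * τ t l)) * dτ l
      = (∑ l, Real.exp (-β * τ t l) * dτ l) / ∑ l, Real.exp (-β * τ t l) := by
    rw [Finset.sum_div]; exact Finset.sum_congr rfl (fun l _ => by ring)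
  rw [e1, e2]
  field_simp
  ring

/-- Core pointwise facts about the Lyapunov function. -/
lemma aux_gibbs (n : ℕ) (p q : Fin n → ℝ) (hp : ∀ k, 0 < p k) (hq : ∀ k, 0 < q k)
    (hps : ∑ k, p k = 1) (hqs : ∑ k, q k = 1) :
    0 ≤ ∑ k, p k * (Real.log (p k) - Real.log (q k)) := by
  have : ∑ k, (p k - q k) ≤ ∑ k, p k * (Real.log (p k) - Real.log (q k)) := by
    apply Finset.sum_le_sum
    intro k _
    have h1 := Real.log_le_sub_one_of_pos (div_pos (hq k) (hp k))
    rw [Real.log_div (hq k).ne' (hp k).ne'] at h1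
    have h2 := mul_le_mul_of_nonneg_left h1 (hp k).le
    have e : p k * (q k / p k - 1) = q k - p k := by
      have := (hp k).ne'
      field_simp
    rw [e] at h2
    linarith
  rw [Finset.sum_sub_distrib, hps, hqs, sub_self] at this
  exact this

lemma aux_logmono (x y : ℝ) (hx : 0 < x) (hy : 0 < y) :
    (y - x) * (Real.log x - Real.log y) ≤ 0 := by
  rcases le_total x y with h | h
  · have := Real.log_le_log hx h
    nlinarith
  · have := Real.log_le_log hy h
    nlinarith

lemma aux_lyap (n : ℕ) (β η ρ : ℝ) (hβ : 0 < β) (hη : 0 < η) (πs : Fin n → ℝ)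
    (p q : ℝ → Fin n → ℝ) (g dτ : Fin n → ℝ) (t c : ℝ)
    (hp : ∀ k, 0 < p t k) (hq : ∀ k, 0 < q t k)
    (hps : ∑ k, p t k = 1) (hqs : ∑ k, q t k = 1)
    (hpd : ∀ k, HasDerivAt (fun s => p s k) (η * (q t k - p t k)) t)
    (hqd : ∀ k, HasDerivAt (fun s => q s k)
      (β * q t k * (∑ l, q t l * dτ l - dτ k)) t)
    (hdτ : ∀ k, dτ k = ρ * (p t k - πs k) + g k * (η * (q t k - p t k)))
    (hg : ∀ k, c ≤ g k) :
    ∃ D, HasDerivAt (fun s => η / β * ∑ k, p s k * (Real.log (p s k) - Real.log (q s k))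
        + ρ / 2 * ∑ k, (p s k - πs k) ^ 2) D t ∧
      D ≤ - c * ∑ k, (η * (q t k - p t k)) ^ 2 := by
  have h1 : ∀ k, HasDerivAt (fun s => p s k * (Real.log (p s k) - Real.log (q s k)))
      (η * (q t k - p t k) * (Real.log (p t k) - Real.log (q t k)) + η * (q t k - p t k)
        - β * p t k * (∑ l, q t l * dτ l - dτ k)) t := by
    intro k
    have := (hpd k).fun_mul (((hpd k).log (hp k).ne').fun_sub ((hqd k).log (hq k).ne'))
    refine this.congr_deriv ?_
    have := (hp k).ne'
    have := (hq k).ne'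
    field_simp
    ring
  have h2 : ∀ k, HasDerivAt (fun s => (p s k - πs k) ^ 2)
      (2 * (p t k - πs k) * (η * (q t k - p t k))) t := by
    intro k
    have := ((hpd k).sub_const (πs k)).fun_pow 2
    refine this.congr_deriv ?_
    norm_num
  refine ⟨_, ((HasDerivAt.fun_sum (u := Finset.univ) (fun k _ => h1 k)).const_mul (η / β)).fun_add
    ((HasDerivAt.fun_sum (u := Finset.univ) (fun k _ => h2 k)).const_mul (ρ / 2)), ?_⟩
  have e1 : ∑ k, (η * (q t k - p t k) * (Real.log (p t k) - Real.log (q t k))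
      + η * (q t k - p t k) - β * p t k * (∑ l, q t l * dτ l - dτ k))
      = η * ∑ k, (q t k - p t k) * (Real.log (p t k) - Real.log (q t k))
        - β * ∑ k, (q t k - p t k) * dτ k := by
    set m := ∑ l, q t l * dτ l with hm
    have a1 : ∑ k, η * (q t k - p t k) = 0 := by
      rw [← Finset.mul_sum, Finset.sum_sub_distrib, hps, hqs]; ring
    have a2 : ∑ k, β * p t k * (m - dτ k) = β * m - β * ∑ k, p t k * dτ k := by
      have : ∀ k, β * p t k * (m - dτ k) = β * m * p t k - β * (p t k * dτ k) := fun k => by ring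
      simp_rw [this]
      rw [Finset.sum_sub_distrib, ← Finset.mul_sum, ← Finset.mul_sum, hps, mul_one]
    have a3 : ∑ k, (q t k - p t k) * dτ k = m - ∑ k, p t k * dτ k := by
      simp_rw [sub_mul]
      rw [Finset.sum_sub_distrib]
    rw [Finset.sum_sub_distrib, Finset.sum_add_distrib, a1, a2, a3]
    have a4 : ∑ k, η * (q t k - p t k) * (Real.log (p t k) - Real.log (q t k))
        = η * ∑ k, (q t k - p t k) * (Real.log (p t k) - Real.log (q t k)) := by
      rw [Finset.mul_sum]
      exact Finset.sum_congr rfl (fun k _ => by ring)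
    rw [a4]
    ring
  have e2 : ∑ k, (q t k - p t k) * (Real.log (p t k) - Real.log (q t k)) ≤ 0 :=
    Finset.sum_nonpos (fun k _ => aux_logmono _ _ (hp k) (hq k))
  have e3 : η * ∑ k, (q t k - p t k) * dτ k =
      ρ / 2 * ∑ k, 2 * (p t k - πs k) * (η * (q t k - p t k))
        + ∑ k, g k * (η * (q t k - p t k)) ^ 2 := by
    rw [Finset.mul_sum, Finset.mul_sum, ← Finset.sum_add_distrib]
    apply Finset.sum_congr rfl
    intro k _
    rw [hdτ k]
    ring
  have e4 : c * ∑ k, (η * (q t k - p t k)) ^ 2 ≤ ∑ k, g k * (η * (q t k - p t k)) ^ 2 := by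
    rw [Finset.mul_sum]
    exact Finset.sum_le_sum (fun k _ => mul_le_mul_of_nonneg_right (hg k) (sq_nonneg _))
  rw [e1]
  have e5 : η / β * (η * ∑ k, (q t k - p t k) * (Real.log (p t k) - Real.log (q t k))
        - β * ∑ k, (q t k - p t k) * dτ k)
      = η ^ 2 / β * (∑ k, (q t k - p t k) * (Real.log (p t k) - Real.log (q t k)))
        - η * ∑ k, (q t k - p t k) * dτ k := by
    field_simp
  rw [e5, e3]
  have : η ^ 2 / β * (∑ k, (q t k - p t k) * (Real.log (p t k) - Real.log (q t k))) ≤ 0 :=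
    mul_nonpos_of_nonneg_of_nonpos (by positivity) e2
  linarith

/-- (Theorem 1: convergence of Model 1 with the PI mechanism.)
For the closed-loop system `π̇ = η (Q(T + B(π)) - π)`, `μ̇ = ρ(π - π*)`,
`T = μ + κ(π - π*)` with `π(0) ∈ int(S)` and bias functions satisfying
Assumption 1 with bias-strength bound `c^H`: if `κ > c^H` then `π(t) → π*`. -/
theorem stmt12 (n : ℕ) (hn : 1 ≤ n) (β η ρ κ : ℝ)
    (hβ : 0 < β) (hη : 0 < η) (hρ : 0 < ρ) (hκ : 0 < κ)
    (πs : Fin n → ℝ) (hπs : πs ∈ simplexInt n)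
    (b b' : Fin n → ℝ → ℝ) (bL bH cL cH : ℝ)
    (hbLH : bL ≤ bH) (hcL : 0 < cL) (hcLH : cL ≤ cH)
    (hb_cont : ∀ k, ContinuousOn (b k) (Set.Icc 0 1))
    (hb_deriv : ∀ k, ∀ q ∈ Set.Ioo (0 : ℝ) 1, HasDerivAt (b k) (b' k q) q)
    (hb'_cont : ∀ k, ContinuousOn (b' k) (Set.Ioo 0 1))
    (hb_anti : ∀ k, StrictAntiOn (b k) (Set.Icc 0 1))
    (hb_bdd : ∀ k, ∀ q ∈ Set.Icc (0 : ℝ) 1, bL ≤ b k q ∧ b k q ≤ bH)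
    (hb'_bdd : ∀ k, ∀ q ∈ Set.Ioo (0 : ℝ) 1, -cH ≤ b' k q ∧ b' k q ≤ -cL)
    (π μ T : ℝ → Fin n → ℝ)
    (hinit : π 0 ∈ simplexInt n)
    (hT : ∀ t, ∀ k, T t k = μ t k + κ * (π t k - πs k))
    (hμd : ∀ t, 0 ≤ t → HasDerivAt μ (fun k => ρ * (π t k - πs k)) t)
    (hπd : ∀ t, 0 ≤ t →
      HasDerivAt π
        (fun k => η * (logitQ n β (fun l => T t l + b l (π t l)) k - π t k)) t)
    (hgain : cH < κ) :
    Filter.Tendsto π Filter.atTop (nhds πs) := by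
  classical
  haveI : Nonempty (Fin n) := ⟨⟨0, hn⟩⟩
  obtain ⟨hπs1, hπs2⟩ := hπs
  obtain ⟨hin1, hin2⟩ := hinit
  set τ : ℝ → Fin n → ℝ := fun t l => T t l + b l (π t l) with hτdef
  set q : ℝ → Fin n → ℝ := fun t => logitQ n β (τ t) with hqdef
  have hqpos : ∀ t k, 0 < q t k := fun t k => logitQ_pos n β (τ t) k
  have hqsum : ∀ t, ∑ k, q t k = 1 := fun t => logitQ_sum n β (τ t)
  have hqle : ∀ t k, q t k ≤ 1 := fun t k => logitQ_le_one n β (τ t) k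
  have hpd : ∀ k t, 0 ≤ t → HasDerivAt (fun s => π s k) (η * (q t k - π t k)) t := by
    intro k t ht
    exact (hasDerivAt_pi.1 (hπd t ht)) k
  have hmd : ∀ k t, 0 ≤ t → HasDerivAt (fun s => μ s k) (ρ * (π t k - πs k)) t := by
    intro k t ht
    exact (hasDerivAt_pi.1 (hμd t ht)) k
  -- invariance of the simplex
  have hppos : ∀ t, 0 ≤ t → ∀ k, 0 < π t k := by
    intro t ht k
    have := aux_decay η (fun s => π s k) (fun s => q s k) (hpd k) hη
      (fun s _ => (hqpos s k).le) t ht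
    have h0 := (hin1 k).1
    have h1 : 0 < Real.exp (η * t) * π t k := lt_of_lt_of_le h0 this
    exact pos_of_mul_pos_right h1 (Real.exp_pos _).le
  have hplt : ∀ t, 0 ≤ t → ∀ k, π t k < 1 := by
    intro t ht k
    have := aux_decay η (fun s => 1 - π s k) (fun s => 1 - q s k) (fun s hs => by
      refine ((hpd k s hs).const_sub 1).congr_deriv ?_
      ring) hη (fun s _ => by linarith [hqle s k]) t ht
    have h0 := (hin1 k).2
    have h1 : 0 < Real.exp (η * t) * (1 - π t k) := lt_of_lt_of_le (by simpa using h0) this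
    have := pos_of_mul_pos_right h1 (Real.exp_pos _).le
    linarith
  have hsd : ∀ t, 0 ≤ t → HasDerivAt (fun s => ∑ k, π s k) (η * (1 - ∑ k, π t k)) t := by
    intro t ht
    refine (HasDerivAt.fun_sum (u := Finset.univ) (fun k _ => hpd k t ht)).congr_deriv ?_
    rw [← Finset.mul_sum, Finset.sum_sub_distrib, hqsum]
  have hpsum : ∀ t, 0 ≤ t → ∑ k, π t k = 1 := by
    intro t ht
    have h1 := aux_decay η (fun s => (∑ k, π s k) - 1) (fun s => 0) (fun s hs => by
      refine ((hsd s hs).sub_const 1).congr_deriv ?_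
      ring) hη (fun s _ => le_rfl) t ht
    have h2 := aux_decay η (fun s => 1 - (∑ k, π s k)) (fun s => 0) (fun s hs => by
      refine ((hsd s hs).const_sub 1).congr_deriv ?_
      ring) hη (fun s _ => le_rfl) t ht
    simp only [hin2, sub_self] at h1 h2
    have h3 := nonneg_of_mul_nonneg_right h1 (Real.exp_pos (η * t))
    have h4 := nonneg_of_mul_nonneg_right h2 (Real.exp_pos (η * t))
    linarith
  -- derivative of τ
  set g : ℝ → Fin n → ℝ := fun t k => κ + b' k (π t k) with hgdef
  have hrest : ∀ k t, 0 ≤ t → HasDerivAt (fun s => κ * (π s k - πs k) + b k (π s k))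
      (g t k * (η * (q t k - π t k))) t := by
    intro k t ht
    have h1 := ((hpd k t ht).sub_const (πs k)).const_mul κ
    have h2 := HasDerivAt.comp t (hb_deriv k (π t k) ⟨hppos t ht k, hplt t ht k⟩) (hpd k t ht)
    refine (h1.fun_add h2).congr_deriv ?_
    simp only [hgdef]
    ring
  have hτeq : ∀ t k, τ t k = μ t k + (κ * (π t k - πs k) + b k (π t k)) := by
    intro t k
    simp only [hτdef, hT]
    ring
  set dτ : ℝ → Fin n → ℝ := fun t k => ρ * (π t k - πs k) + g t k * (η * (q t k - π t k))
    with hdτdef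
  have hτd : ∀ k t, 0 ≤ t → HasDerivAt (fun s => τ s k) (dτ t k) t := by
    intro k t ht
    simp_rw [hτeq]
    exact (hmd k t ht).fun_add (hrest k t ht)
  have hqd : ∀ k t, 0 ≤ t → HasDerivAt (fun s => q s k)
      (β * q t k * (∑ l, q t l * dτ t l - dτ t k)) t := by
    intro k t ht
    exact logitQ_hasDerivAt n β τ (dτ t) t (fun l => hτd l t ht) k
  -- bounds
  have hgb : ∀ t, 0 ≤ t → ∀ k, κ - cH ≤ g t k ∧ g t k ≤ κ := by
    intro t ht k
    have := hb'_bdd k (π t k) ⟨hppos t ht k, hplt t ht k⟩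
    simp only [hgdef]
    constructor <;> linarith [this.1, this.2]
  have hgabs : ∀ t, 0 ≤ t → ∀ k, |g t k| ≤ κ := by
    intro t ht k
    have := hgb t ht k
    rw [abs_le]
    constructor <;> linarith [this.1, this.2]
  have hqpb : ∀ t, 0 ≤ t → ∀ k, |η * (q t k - π t k)| ≤ η := by
    intro t ht k
    rw [abs_mul, abs_of_pos hη]
    have : |q t k - π t k| ≤ 1 := by
      rw [abs_le]
      constructor <;> linarith [hqpos t k, hqle t k, hppos t ht k, hplt t ht k]
    nlinarith
  have hpsb : ∀ t, 0 ≤ t → ∀ k, |π t k - πs k| ≤ 1 := by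
    intro t ht k
    rw [abs_le]
    constructor <;> linarith [(hπs1 k).1, (hπs1 k).2, hppos t ht k, hplt t ht k]
  have hdτb : ∀ t, 0 ≤ t → ∀ k, |dτ t k| ≤ ρ + κ * η := by
    intro t ht k
    refine (abs_add_le _ _).trans ?_
    rw [abs_mul, abs_mul (g t k), abs_of_pos hρ]
    have h1 := mul_le_mul (hgabs t ht k) (hqpb t ht k) (abs_nonneg _) hκ.le
    have h2 := mul_le_mul_of_nonneg_left (hpsb t ht k) hρ.le
    linarith
  set D := ρ + κ * η with hD
  have hD0 : 0 < D := by positivity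
  have hqdb : ∀ t, 0 ≤ t → ∀ k,
      |β * q t k * (∑ l, q t l * dτ t l - dτ t k)| ≤ β * (2 * D) := by
    intro t ht k
    have h1 : |∑ l, q t l * dτ t l| ≤ D := by
      refine (Finset.abs_sum_le_sum_abs _ _).trans ?_
      calc _ ≤ ∑ l, q t l * D := by
            apply Finset.sum_le_sum
            intro l _
            rw [abs_mul, abs_of_pos (hqpos t l)]
            exact mul_le_mul_of_nonneg_left (hdτb t ht l) (hqpos t l).le
        _ = D := by rw [← Finset.sum_mul, hqsum, one_mul]
    have h2 : |∑ l, q t l * dτ t l - dτ t k| ≤ 2 * D := by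
      refine (abs_sub _ _).trans ?_
      linarith [hdτb t ht k]
    rw [abs_mul, abs_mul, abs_of_pos hβ, abs_of_pos (hqpos t k)]
    apply mul_le_mul _ h2 (abs_nonneg _) hβ.le
    nlinarith [hqle t k]
  -- the Lyapunov function
  have hV : ∀ t, ∃ V', 0 ≤ t → HasDerivAt
      (fun s => η / β * ∑ k, π s k * (Real.log (π s k) - Real.log (q s k))
        + ρ / 2 * ∑ k, (π s k - πs k) ^ 2) V' t ∧
      V' ≤ - (κ - cH) * ∑ k, (η * (q t k - π t k)) ^ 2 := by
    intro t
    by_cases ht : 0 ≤ t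
    · obtain ⟨V', h⟩ := aux_lyap n β η ρ hβ hη πs π q (g t) (dτ t) t (κ - cH) (hppos t ht)
        (hqpos t) (hpsum t ht) (hqsum t) (fun k => hpd k t ht) (fun k => hqd k t ht)
        (fun k => rfl) (fun k => (hgb t ht k).1)
      exact ⟨V', fun _ => h⟩
    · exact ⟨0, fun h => absurd h ht⟩
  choose V' hV' using hV
  have hdot : ∀ k, Tendsto (fun t => η * (q t k - π t k)) atTop (𝓝 0) := by
    intro k
    refine aux_barbalat _ V' _ (fun t => η * (β * q t k * (∑ l, q t l * dτ t l - dτ t k)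
      - η * (q t k - π t k))) (κ - cH) (η * (β * (2 * D) + η)) (by linarith) (by positivity)
      (fun t ht => (hV' t ht).1) ?_ ?_ ?_ ?_
    · intro t ht
      have := aux_gibbs n (π t) (q t) (hppos t ht) (hqpos t) (hpsum t ht) (hqsum t)
      have : 0 ≤ ∑ k, (π t k - πs k) ^ 2 := Finset.sum_nonneg (fun k _ => sq_nonneg _)
      positivity
    · intro t ht
      exact ((hqd k t ht).fun_sub (hpd k t ht)).const_mul η
    · intro t ht
      rw [abs_mul, abs_of_pos hη]
      apply mul_le_mul_of_nonneg_left _ hη.le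
      refine (abs_sub _ _).trans ?_
      linarith [hqdb t ht k, hqpb t ht k]
    · intro t ht
      refine (hV' t ht).2.trans ?_
      have : (η * (q t k - π t k)) ^ 2 ≤ ∑ k, (η * (q t k - π t k)) ^ 2 :=
        Finset.single_le_sum (f := fun k => (η * (q t k - π t k)) ^ 2)
          (fun k _ => sq_nonneg _) (Finset.mem_univ k)
      nlinarith
  have hdiff : ∀ k, Tendsto (fun t => q t k - π t k) atTop (𝓝 0) := by
    intro k
    have := (hdot k).const_mul η⁻¹
    rw [mul_zero] at this
    refine this.congr (fun t => ?_)
    field_simp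
  -- boundedness of μ
  have hμsum : ∀ t, 0 ≤ t → ∑ k, μ t k = ∑ k, μ 0 k := by
    intro t ht
    have := aux_incr (fun s => ∑ k, μ s k) (fun s => ∑ k, ρ * (π s k - πs k))
      (fun s hs => HasDerivAt.fun_sum (fun k _ => hmd k s hs)) 0 0 t le_rfl ht (by
        intro s hs
        rw [← Finset.mul_sum, Finset.sum_sub_distrib, hpsum s hs.1, hπs2]
        simp)
    rw [zero_mul] at this
    have := abs_eq_zero.1 (le_antisymm this (abs_nonneg _))
    linarith
  set C := ∑ k, μ 0 k with hC
  have hrestb : ∀ t, 0 ≤ t → ∀ k, bL - κ ≤ κ * (π t k - πs k) + b k (π t k) ∧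
      κ * (π t k - πs k) + b k (π t k) ≤ bH + κ := by
    intro t ht k
    have h1 := hb_bdd k (π t k) ⟨(hppos t ht k).le, (hplt t ht k).le⟩
    have h2 := abs_le.1 (hpsb t ht k)
    constructor <;> nlinarith [h1.1, h1.2, h2.1, h2.2]
  have hup : ∀ k, ∃ K t0, 0 ≤ t0 ∧ ∀ t, t0 ≤ t → μ t k ≤ K := by
    intro k
    have hs0 := (hπs1 k).1
    obtain ⟨N, hN⟩ := (Metric.tendsto_atTop.1 (hdiff k)) (πs k / 2) (by positivity)
    obtain ⟨R, hR⟩ : ∃ R, Real.exp (-β * R) ≤ πs k / 2 := by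
      refine ⟨-(Real.log (πs k / 2)) / β, ?_⟩
      have : -β * (-(Real.log (πs k / 2)) / β) = Real.log (πs k / 2) := by field_simp
      rw [this, Real.exp_log (by positivity)]
    obtain ⟨K, hK⟩ := aux_trap (fun t => μ t k) (fun t => ρ * (π t k - πs k)) (hmd k)
      (R + |C| + (bH + κ) - (bL - κ)) (max N 0) (le_max_right _ _) (by
        intro t ht hM
        have ht0 : 0 ≤ t := (le_max_right _ _).trans ht
        have htN : N ≤ t := (le_max_left _ _).trans ht
        have h1 := hN t htN
        rw [Real.dist_eq, sub_zero] at h1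
        have h1 := (abs_lt.1 h1).1
        obtain ⟨j, hj⟩ : ∃ j, μ t j ≤ |C| := by
          by_contra hcon
          push Not at hcon
          have h2 : ∑ k : Fin n, |C| < ∑ k, μ t k :=
            Finset.sum_lt_sum_of_nonempty Finset.univ_nonempty (fun j _ => hcon j)
          rw [hμsum t ht0] at h2
          simp only [Finset.sum_const, Finset.card_univ, Fintype.card_fin, nsmul_eq_mul] at h2
          have h3 : (1 : ℝ) ≤ n := by exact_mod_cast hn
          nlinarith [le_abs_self C, abs_nonneg C]
        have h4 : R ≤ τ t k - τ t j := by
          rw [hτeq, hτeq]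
          linarith [(hrestb t ht0 k).1, (hrestb t ht0 j).2]
        have h5 : q t k ≤ πs k / 2 := by
          refine (logitQ_le_exp n β (τ t) k j).trans (le_trans ?_ hR)
          apply Real.exp_le_exp.2
          nlinarith
        have : π t k - πs k < 0 := by linarith
        exact mul_neg_of_pos_of_neg hρ this)
    exact ⟨K, max N 0, le_max_right _ _, hK⟩
  choose K t0 ht00 hK using hup
  obtain ⟨M, hM⟩ : ∃ M, ∀ k, K k ≤ M := by
    obtain ⟨M, hM⟩ := (Set.finite_range K).bddAbove
    exact ⟨M, fun k => hM ⟨k, rfl⟩⟩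
  obtain ⟨S, hS⟩ : ∃ S, ∀ k, t0 k ≤ S := by
    obtain ⟨M, hM⟩ := (Set.finite_range t0).bddAbove
    exact ⟨M, fun k => hM ⟨k, rfl⟩⟩
  have hS0 : 0 ≤ S := (ht00 ⟨0, hn⟩).trans (hS _)
  have hμup : ∀ t, S ≤ t → ∀ k, μ t k ≤ M := fun t ht k => (hK k t ((hS k).trans ht)).trans (hM k)
  have hμlow : ∀ t, S ≤ t → ∀ k, M - (n * M - C) ≤ μ t k := by
    intro t ht k
    have h1 : M - μ t k ≤ ∑ k, (M - μ t k) :=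
      Finset.single_le_sum (f := fun k => M - μ t k)
        (fun j _ => by linarith [hμup t ht j]) (Finset.mem_univ k)
    rw [Finset.sum_sub_distrib, hμsum t (hS0.trans ht)] at h1
    simp only [Finset.sum_const, Finset.card_univ, Fintype.card_fin, nsmul_eq_mul] at h1
    linarith
  obtain ⟨q0, hq0, hqlow⟩ : ∃ q0 > 0, ∀ t, S ≤ t → ∀ k, q0 ≤ q t k := by
    set R := max (M + (bH + κ)) (-(M - (n * M - C) + (bL - κ))) with hR
    refine ⟨Real.exp (-β * R) / (n * Real.exp (β * R)), ?_, ?_⟩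
    · have : (0 : ℝ) < n := by exact_mod_cast hn
      have := Real.exp_pos (-β * R)
      have := Real.exp_pos (β * R)
      positivity
    · intro t ht k
      refine logitQ_lower n β R hβ (τ t) ?_ k
      intro l
      rw [hτeq, abs_le]
      have h1 := hrestb t (hS0.trans ht) l
      have h2 := hμup t ht l
      have h3 := hμlow t ht l
      have h4 := le_max_left (M + (bH + κ)) (-(M - (n * M - C) + (bL - κ)))
      have h5 := le_max_right (M + (bH + κ)) (-(M - (n * M - C) + (bL - κ)))
      rw [← hR] at h4 h5
      constructor <;> linarith [h1.1, h1.2]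
  -- increments
  have hshift : Tendsto (fun t : ℝ => t + 1) atTop atTop := tendsto_atTop_add_const_right _ _ tendsto_id
  have hΔp : ∀ k, Tendsto (fun t => π (t + 1) k - π t k) atTop (𝓝 0) := fun k =>
    aux_window (fun t => π t k) _ (hpd k) (hdot k)
  have hΔq : ∀ k, Tendsto (fun t => q (t + 1) k - q t k) atTop (𝓝 0) := by
    intro k
    have := (((hdiff k).comp hshift).sub (hdiff k)).add (hΔp k)
    simp only [sub_zero, add_zero] at this
    refine this.congr (fun t => ?_)
    simp only [Function.comp]
    ring
  have hΔlog : ∀ k, Tendsto (fun t => Real.log (q (t + 1) k) - Real.log (q t k)) atTop (𝓝 0) := by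
    intro k
    have h1 : Tendsto (fun t => (q (t + 1) k - q t k) / q t k) atTop (𝓝 0) := by
      have h2 := ((hΔq k).abs).mul_const q0⁻¹
      rw [abs_zero, zero_mul] at h2
      refine squeeze_zero_norm' ?_ h2
      filter_upwards [eventually_ge_atTop S] with t ht
      rw [Real.norm_eq_abs, abs_div, abs_of_pos (hqpos t k), div_eq_mul_inv]
      apply mul_le_mul_of_nonneg_left _ (abs_nonneg _)
      exact inv_anti₀ hq0 (hqlow t ht k)
    have h3 : Tendsto (fun t => 1 + (q (t + 1) k - q t k) / q t k) atTop (𝓝 1) := by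
      simpa using h1.const_add 1
    have h4 := h3.log one_ne_zero
    rw [Real.log_one] at h4
    refine h4.congr (fun t => ?_)
    rw [← Real.log_div (hqpos _ k).ne' (hqpos _ k).ne']
    congr 1
    have := (hqpos t k).ne'
    field_simp
    ring
  have hΔrest : ∀ k, Tendsto (fun t => (κ * (π (t + 1) k - πs k) + b k (π (t + 1) k))
      - (κ * (π t k - πs k) + b k (π t k))) atTop (𝓝 0) := by
    intro k
    refine aux_window (fun t => κ * (π t k - πs k) + b k (π t k)) _ (hrest k) ?_
    have h2 := ((hdot k).abs).const_mul κ
    rw [abs_zero, mul_zero] at h2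
    refine squeeze_zero_norm' ?_ h2
    filter_upwards [eventually_ge_atTop 0] with t ht
    rw [Real.norm_eq_abs, abs_mul]
    exact mul_le_mul_of_nonneg_right (hgabs t ht k) (abs_nonneg _)
  have hΔμ : ∀ k, Tendsto (fun t => μ (t + 1) k - μ t k - ρ * (π t k - πs k)) atTop (𝓝 0) := by
    intro k
    refine aux_window2 (fun t => μ t k) (fun t => ρ * (π t k - πs k))
      (fun t => ρ * (η * (q t k - π t k))) (hmd k) ?_ ?_
    · intro t ht
      exact ((hpd k t ht).sub_const _).const_mul ρ
    · simpa using (hdot k).const_mul ρ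
  set z : ℝ → ℝ := fun t => (1 / β) * (Real.log (∑ l, Real.exp (-β * τ (t + 1) l))
    - Real.log (∑ l, Real.exp (-β * τ t l))) with hz
  have hkey : ∀ k, Tendsto (fun t => ρ * (π t k - πs k) + z t) atTop (𝓝 0) := by
    intro k
    have h := (((hΔlog k).const_mul (-(1 / β))).sub (hΔrest k)).sub (hΔμ k)
    simp only [mul_zero, sub_zero] at h
    refine h.congr (fun t => ?_)
    have l1 : Real.log (q t k) = _ := logitQ_log n β (τ t) k
    have l2 : Real.log (q (t + 1) k) = _ := logitQ_log n β (τ (t + 1)) k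
    rw [l1, l2, hτeq (t + 1) k, hτeq t k]
    simp only [hz]
    field_simp
    ring
  have hz0 : Tendsto z atTop (𝓝 0) := by
    have h := (tendsto_finsetSum Finset.univ (fun k _ => hkey k)).const_mul ((n : ℝ)⁻¹)
    simp only [Finset.sum_const_zero, mul_zero] at h
    refine h.congr' ?_
    filter_upwards [eventually_ge_atTop 0] with t ht
    rw [Finset.sum_add_distrib, ← Finset.mul_sum, Finset.sum_sub_distrib, hpsum t ht, hπs2]
    have : (n : ℝ) ≠ 0 := by exact_mod_cast (by omega : n ≠ 0)
    simp [this]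
  rw [tendsto_pi_nhds]
  intro k
  have h := (((hkey k).sub hz0).const_mul ρ⁻¹).add_const (πs k)
  simp only [sub_zero, mul_zero, zero_add] at h
  refine h.congr (fun t => ?_)
  field_simp
  ring
end

section
/- Let n ≥ 1, ρ > 0, κ > 0, α > 0, T̄ > 0 and π* ∈ int(S). Let π : [0,∞) → ℝⁿ satisfy π(t) ∈ int(S) for all t ≥ 0, and let μ : [0,∞) → ℝⁿ be differentiable with μ_k(0) ≤ 0 and μ̇_k(t) = min{ρ (π_k(t) − π*_k), −α μ_k(t)} for each k; set T(t) := T̄·1ⁿ + μ(t) + κ (π(t) − π*). Then μ_k(t) ≤ 0 for every k and every t ≥ 0, and consequently T_k(t) < T̄ + κ for every k and every t ≥ 0. -/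
/-- The saturated PI mechanism
`μ̇_k = min{ρ(π_k - π*_k), -α μ_k}` with `μ_k(0) ≤ 0` keeps `μ_k(t) ≤ 0` for
all `t ≥ 0`; consequently `T_k(t) = T̄ + μ_k(t) + κ(π_k(t) - π*_k) < T̄ + κ`. -/
theorem stmt13 (n : ℕ) (hn : 1 ≤ n) (ρ κ α Tbar : ℝ)
    (hρ : 0 < ρ) (hκ : 0 < κ) (hα : 0 < α) (hTbar : 0 < Tbar)
    (πs : Fin n → ℝ) (hπs : πs ∈ simplexInt n)
    (π μ : ℝ → Fin n → ℝ)
    (hπS : ∀ t, 0 ≤ t → π t ∈ simplexInt n)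
    (hμ0 : ∀ k, μ 0 k ≤ 0)
    (hμd : ∀ t, 0 ≤ t →
      HasDerivAt μ (fun k => min (ρ * (π t k - πs k)) (-α * μ t k)) t)
    (T : ℝ → Fin n → ℝ)
    (hT : ∀ t, ∀ k, T t k = Tbar + μ t k + κ * (π t k - πs k)) :
    ∀ t, 0 ≤ t → ∀ k, μ t k ≤ 0 ∧ T t k < Tbar + κ := by
  intro t ht k
  have hd : ∀ s, 0 ≤ s → HasDerivAt (fun s => Real.exp (α * s) * μ s k)
      (Real.exp (α * s) * (α * 1) * μ s k
        + Real.exp (α * s) * min (ρ * (π s k - πs k)) (-α * μ s k)) s := by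
    intro s hs
    exact (((hasDerivAt_id s).const_mul α).exp).mul ((hasDerivAt_pi.1 (hμd s hs)) k)
  have hanti : AntitoneOn (fun s => Real.exp (α * s) * μ s k) (Set.Ici 0) := by
    apply antitoneOn_of_deriv_nonpos (convex_Ici 0)
    · intro s hs
      exact (hd s hs).continuousAt.continuousWithinAt
    · intro s hs
      exact (hd s (interior_subset hs)).differentiableAt.differentiableWithinAt
    · intro s hs
      rw [(hd s (interior_subset hs)).deriv]
      have h1 := mul_le_mul_of_nonneg_left
        (min_le_right (ρ * (π s k - πs k)) (-α * μ s k)) (Real.exp_pos (α * s)).le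
      linarith
  have h := hanti (Set.mem_Ici.2 le_rfl) (Set.mem_Ici.2 ht) ht
  have hμ : μ t k ≤ 0 := by
    have h0 := hμ0 k
    simp only [mul_zero, Real.exp_zero, one_mul] at h
    by_contra hc
    have := mul_pos (Real.exp_pos (α * t)) (not_le.1 hc)
    linarith
  refine ⟨hμ, ?_⟩
  rw [hT]
  have h1 := ((hπS t ht).1 k).2
  have h2 := (hπs.1 k).1
  have h3 : κ * (π t k - πs k) < κ * 1 := mul_lt_mul_of_pos_left (by linarith) hκ
  linarith
end

section
/- Let n ≥ 1, β > 0, η > 0, ρ > 0, κ > 0, α > 1/(2κ), T̄ > 0, π* ∈ int(S), and let w_k (k = 1,…,n) satisfy Assumption 2 with bounds w^L, w^H, v^H, v^L. Let π, μ : [0,∞) → ℝⁿ be differentiable with π(0) ∈ int(S) and μ_k(0) ≤ 0, and suppose for all t ≥ 0: T(t) = T̄·1ⁿ + μ(t) + κ (π(t) − π*), μ̇_k(t) = min{ρ (π_k(t) − π*_k), −α μ_k(t)} for each k, and π̇(t) = η (Q(W(π(t)) T(t)) − π(t)) (the closed-loop system of Model 2 with the saturated PI mechanism). If κ > 2 v^H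 (T̄ + κ) / w^L (noting that the mechanism guarantees T_k(t) ≤ T_max := T̄ + κ for all k and t), then π(t) → π* as t → ∞. -/
open Filter Topology Set

lemma aux_antitone (f : ℝ → ℝ) (hc : ContinuousOn f (Ici 0))
    (h : ∀ t, 0 ≤ t → ∃ (H : ℝ → ℝ) (d : ℝ), HasDerivAt H d t ∧ d ≤ 0 ∧ H t = f t ∧
      ∀ᶠ z in 𝓝[>] t, f z ≤ H z) : ∀ s t, 0 ≤ s → s ≤ t → f t ≤ f s := by
  intro s t hs hst
  have := image_le_of_liminf_slope_right_le_deriv_boundary (f := f) (a := s) (b := t)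
    (hc.mono (fun x hx => le_trans hs hx.1)) (B := fun _ => f s) (B' := fun _ => 0) le_rfl
    continuousOn_const (fun x _ => hasDerivWithinAt_const _ _ _) ?_ (x := t) ⟨hst, le_rfl⟩
  · exact this
  intro x hx r hr
  obtain ⟨H, d, hd, hd0, he, hle⟩ := h x (le_trans hs hx.1)
  have h1 := hd.hasDerivWithinAt (s := Ioi x)
  rw [hasDerivWithinAt_iff_tendsto_slope' (by simp)] at h1
  have h2 := h1.eventually (gt_mem_nhds (show d < r from lt_of_le_of_lt hd0 hr))
  refine Eventually.frequently ?_
  filter_upwards [h2, hle, self_mem_nhdsWithin] with z hz1 hz2 hz3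
  refine lt_of_le_of_lt ?_ hz1
  rw [slope_def_field, slope_def_field, he]
  have : 0 < z - x := sub_pos.2 hz3
  gcongr

noncomputable def auxU (w : ℝ → ℝ) (ρ α ps p m : ℝ) : ℝ :=
  ∫ q in ps..p, w q * min (ρ * (q - ps)) (-α * m)

lemma auxU_cont (w : ℝ → ℝ) (hw : Continuous w) (ρ α ps : ℝ) (p m : ℝ → ℝ) (s : Set ℝ)
    (hp : ContinuousOn p s) (hm : ContinuousOn m s) :
    ContinuousOn (fun t => auxU w ρ α ps (p t) (m t)) s := by
  have := intervalIntegral.continuous_parametric_primitive_of_continuous (μ := MeasureTheory.volume)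
    (f := fun m q => w q * min (ρ * (q - ps)) (-α * m)) (a₀ := ps) (by fun_prop)
  exact this.comp_continuousOn (hm.prodMk hp)

lemma auxU_int (w : ℝ → ℝ) (hw : Continuous w) (ρ α ps m a b : ℝ) :
    IntervalIntegrable (fun q => w q * min (ρ * (q - ps)) (-α * m)) MeasureTheory.volume a b :=
  Continuous.intervalIntegrable (by fun_prop) _ _

lemma auxU_lip (w : ℝ → ℝ) (hw : Continuous w) (wH : ℝ) (hb : ∀ q, 0 ≤ w q ∧ w q ≤ wH)
    (ρ α ps p m m' : ℝ) (hα : 0 < α) :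
    |auxU w ρ α ps p m - auxU w ρ α ps p m'| ≤ wH * (α * |m - m'|) * |p - ps| := by
  unfold auxU
  rw [← intervalIntegral.integral_sub (auxU_int w hw ..) (auxU_int w hw ..)]
  rw [← Real.norm_eq_abs]
  refine intervalIntegral.norm_integral_le_of_norm_le_const ?_
  intro q _
  rw [← mul_sub, Real.norm_eq_abs, abs_mul, abs_of_nonneg (hb q).1]
  have h1 : |min (ρ * (q - ps)) (-α * m) - min (ρ * (q - ps)) (-α * m')| ≤ α * |m - m'| := by
    refine (abs_min_sub_min_le_max _ _ _ _).trans ?_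
    have : -α * m - -α * m' = -α * (m - m') := by ring
    rw [this, abs_mul, abs_neg, abs_of_pos hα]
    simp
    positivity
  exact mul_le_mul (hb q).2 h1 (abs_nonneg _) ((hb q).1.trans (hb q).2)

lemma auxU_bd (w : ℝ → ℝ) (wH : ℝ) (hb : ∀ q, 0 ≤ w q ∧ w q ≤ wH)
    (ρ α ps p m : ℝ) (hα : 0 < α) (hρ : 0 < ρ) (hm : m ≤ 0) (hps : 0 < ps ∧ ps < 1)
    (hp : 0 < p ∧ p < 1) :
    |auxU w ρ α ps p m| ≤ wH * ρ := by
  unfold auxU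
  have h0 : 0 ≤ wH := (hb 0).1.trans (hb 0).2
  rw [← Real.norm_eq_abs]
  refine (intervalIntegral.norm_integral_le_of_norm_le_const (C := wH * ρ) ?_).trans ?_
  · intro q hq
    rw [uIoc, mem_Ioc] at hq
    have hq1 : 0 < q := lt_of_le_of_lt (le_min hps.1.le hp.1.le) hq.1
    have hq2 : q < 1 := lt_of_le_of_lt hq.2 (max_lt hps.2 hp.2)
    rw [Real.norm_eq_abs, abs_mul, abs_of_nonneg (hb q).1]
    refine mul_le_mul (hb q).2 ?_ (abs_nonneg _) h0
    have hm' : 0 ≤ -α * m := by nlinarith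
    rw [abs_le]
    constructor
    · refine le_min ?_ ?_ <;> nlinarith
    · refine (min_le_left _ _).trans ?_
      nlinarith
  · have : |p - ps| ≤ 1 := by rw [abs_le]; constructor <;> linarith
    have : 0 ≤ wH * ρ := by positivity
    nlinarith

lemma auxU_major (w : ℝ → ℝ) (hw : Continuous w) (wH : ℝ) (hb : ∀ q, 0 ≤ w q ∧ w q ≤ wH)
    (ρ α ps p' t : ℝ) (p m : ℝ → ℝ) (hα : 0 < α) (hρ : 0 < ρ)
    (hp : HasDerivAt p p' t)
    (hm : HasDerivAt m (min (ρ * (p t - ps)) (-α * m t)) t)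
    (hmt : ∀ z, t ≤ z → m z ≤ 0) :
    ∃ H : ℝ → ℝ, HasDerivAt H (w (p t) * min (ρ * (p t - ps)) (-α * m t) * p') t ∧
      H t = auxU w ρ α ps (p t) (m t) ∧
      ∀ᶠ z in 𝓝[>] t, auxU w ρ α ps (p z) (m z) ≤ H z := by
  have hK : HasDerivAt (fun z => auxU w ρ α ps (p z) (m t))
      (w (p t) * min (ρ * (p t - ps)) (-α * m t) * p') t := by
    have hc : Continuous (fun q => w q * min (ρ * (q - ps)) (-α * m t)) := by fun_prop
    have := (hc.integral_hasStrictDerivAt ps (p t)).hasDerivAt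
    exact this.comp t hp
  have hm0 : m t ≤ 0 := hmt t le_rfl
  rcases lt_or_ge (p t - ps) 0 with he | he
  · refine ⟨_, hK, rfl, ?_⟩
    have h1 : ∀ᶠ z in 𝓝[>] t, p z < ps :=
      (hp.continuousAt.eventually (gt_mem_nhds (by linarith))).filter_mono nhdsWithin_le_nhds
    filter_upwards [h1, self_mem_nhdsWithin] with z hz1 hz2
    refine le_of_eq ?_
    refine intervalIntegral.integral_congr ?_
    intro q hq
    rw [uIcc_of_ge hz1.le] at hq
    have hz3 := hmt z (le_of_lt hz2)
    have : q - ps ≤ 0 := by linarith [hq.2]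
    simp only
    rw [min_eq_left (by nlinarith), min_eq_left (by nlinarith)]
  rcases lt_or_ge 0 (min (ρ * (p t - ps)) (-α * m t)) with hpos | hneg
  · refine ⟨_, hK, rfl, ?_⟩
    have he' : ps < p t := by
      have := (lt_min_iff.1 hpos).1
      have := (pos_iff_pos_of_mul_pos this).1 hρ
      linarith
    have h1 : ∀ᶠ z in 𝓝[>] t, ps < p z :=
      (hp.continuousAt.eventually (lt_mem_nhds he')).filter_mono nhdsWithin_le_nhds
    have h2 := hm.hasDerivWithinAt (s := Ioi t)
    rw [hasDerivWithinAt_iff_tendsto_slope' (by simp)] at h2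
    have h3 := h2.eventually (lt_mem_nhds hpos)
    filter_upwards [h1, h3, self_mem_nhdsWithin] with z hz1 hz2 hz3
    have hz4 : m t < m z := by
      rw [slope_def_field] at hz2
      have h5 : 0 < z - t := sub_pos.2 hz3
      have := (div_pos_iff_of_pos_right h5).1 hz2
      linarith
    refine intervalIntegral.integral_mono_on hz1.le (auxU_int w hw ..) (auxU_int w hw ..) ?_
    intro q hq
    refine mul_le_mul_of_nonneg_left ?_ (hb q).1
    refine min_le_min le_rfl ?_
    nlinarith
  · have h0 : min (ρ * (p t - ps)) (-α * m t) = 0 := by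
      refine le_antisymm hneg (le_min ?_ ?_) <;> nlinarith
    have habs : HasDerivAt (fun z => |m z - m t|) 0 t := by
      rw [h0] at hm
      rw [hasDerivAt_iff_isLittleO] at hm ⊢
      simp only [smul_zero, sub_zero, sub_self, abs_zero] at hm ⊢
      exact hm.abs_left
    set R := |p t - ps| + 1 with hR
    refine ⟨fun z => auxU w ρ α ps (p z) (m t) + wH * α * R * |m z - m t|, ?_, by simp, ?_⟩
    · have := hK.add (habs.const_mul (wH * α * R))
      rw [mul_zero, add_zero] at this
      exact this
    · have hcp : ContinuousAt (fun z => |p z - ps|) t := (hp.continuousAt.sub continuousAt_const).abs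
      have h1 : ∀ᶠ z in 𝓝[>] t, |p z - ps| < R :=
        (hcp.eventually (gt_mem_nhds (by simp [hR]))).filter_mono nhdsWithin_le_nhds
      filter_upwards [h1] with z hz
      have h2 := auxU_lip w hw wH hb ρ α ps (p z) (m z) (m t) hα
      have h3 := (abs_le.1 h2).2
      have hwH : 0 ≤ wH := (hb 0).1.trans (hb 0).2
      have : wH * (α * |m z - m t|) * |p z - ps| ≤ wH * (α * |m z - m t|) * R := by gcongr
      linarith

lemma aux_storage (n : ℕ) (hn : 1 ≤ n) (β η t : ℝ) (hβ : 0 < β) (hη : 0 < η)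
    (τ p : ℝ → Fin n → ℝ) (τ' p' : Fin n → ℝ)
    (hτ : ∀ k, HasDerivAt (fun z => τ z k) (τ' k) t)
    (hp : ∀ k, HasDerivAt (fun z => p z k) (p' k) t)
    (hp' : ∀ k, p' k = η * (logitQ n β (τ t) k - p t k))
    (hpos : ∀ k, 0 < p t k) (hsum : ∑ k, p t k = 1) :
    ∃ D, HasDerivAt (fun z => storageS n η β (τ z) (p z)) D t ∧ D ≤ - ∑ k, p' k * τ' k := by
  have : Nonempty (Fin n) := ⟨⟨0, hn⟩⟩
  set Z := ∑ l, Real.exp (-β * τ t l) with hZ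
  have hZpos : 0 < Z := Finset.sum_pos (fun _ _ => Real.exp_pos _) Finset.univ_nonempty
  have hQ : ∀ k, logitQ n β (τ t) k = Real.exp (-β * τ t k) / Z := fun k => rfl
  have hQpos : ∀ k, 0 < logitQ n β (τ t) k := fun k => by rw [hQ]; positivity
  have hQsum : ∑ k, logitQ n β (τ t) k = 1 := by
    simp_rw [hQ]; rw [← Finset.sum_div]; exact div_self hZpos.ne'
  have hp's : ∑ k, p' k = 0 := by
    simp_rw [hp']; rw [← Finset.mul_sum, Finset.sum_sub_distrib, hQsum, hsum]; simp
  have hlogQ : ∀ k, Real.log (logitQ n β (τ t) k) = -β * τ t k - Real.log Z := fun k => by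
    rw [hQ, Real.log_div (Real.exp_pos _).ne' hZpos.ne', Real.log_exp]
  have h1 : HasDerivAt (fun z => ∑ k, p z k * τ z k) (∑ k, (p' k * τ t k + p t k * τ' k)) t :=
    HasDerivAt.fun_sum fun k _ => (hp k).mul (hτ k)
  have h2 : HasDerivAt (fun z => ∑ k, p z k * Real.log (p z k))
      (∑ k, (p' k * Real.log (p t k) + p t k * (p' k / p t k))) t :=
    HasDerivAt.fun_sum fun k _ => (hp k).mul ((hp k).log (hpos k).ne')
  have h3 : HasDerivAt (fun z => ∑ k, Real.exp (-β * τ z k))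
      (∑ k, (Real.exp (-β * τ t k) * (-β * τ' k))) t :=
    HasDerivAt.fun_sum fun k _ => ((hτ k).const_mul (-β)).exp
  have h4 := h3.log hZpos.ne'
  have h5 := ((h1.add (h2.const_mul (1 / β))).add (h4.const_mul (1 / β))).const_mul η
  refine ⟨_, h5, ?_⟩
  have e1 : (∑ k, (Real.exp (-β * τ t k) * (-β * τ' k))) / Z
      = -β * ∑ k, logitQ n β (τ t) k * τ' k := by
    rw [Finset.sum_div, Finset.mul_sum]
    refine Finset.sum_congr rfl fun k _ => ?_
    rw [hQ]; ring
  have e2 : ∑ k, (p' k * Real.log (p t k) + p t k * (p' k / p t k))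
      = ∑ k, p' k * Real.log (p t k) := by
    rw [Finset.sum_add_distrib]
    have : ∑ k, p t k * (p' k / p t k) = ∑ k, p' k :=
      Finset.sum_congr rfl fun k _ => by field_simp [(hpos k).ne']
    rw [this, hp's, add_zero]
  have e3 : ∑ k, p' k * τ t k = -(1 / β) * ∑ k, p' k * Real.log (logitQ n β (τ t) k) := by
    have : ∑ k, p' k * Real.log (logitQ n β (τ t) k)
        = -β * ∑ k, p' k * τ t k - (∑ k, p' k) * Real.log Z := by
      rw [Finset.mul_sum, Finset.sum_mul, ← Finset.sum_sub_distrib]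
      refine Finset.sum_congr rfl fun k _ => ?_
      rw [hlogQ]; ring
    rw [this, hp's]; field_simp; ring
  have e4 : ∑ k, p' k * (Real.log (p t k) - Real.log (logitQ n β (τ t) k)) ≤ 0 := by
    refine Finset.sum_nonpos fun k _ => ?_
    rw [hp', mul_assoc]
    refine mul_nonpos_of_nonneg_of_nonpos hη.le ?_
    rcases le_total (logitQ n β (τ t) k) (p t k) with h | h
    · have := Real.log_le_log (hQpos k) h
      nlinarith
    · have := Real.log_le_log (hpos k) h
      nlinarith
  have e5 : ∑ k, p' k * τ' k
      = η * (∑ k, logitQ n β (τ t) k * τ' k - ∑ k, p t k * τ' k) := by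
    rw [← Finset.sum_sub_distrib, Finset.mul_sum]
    refine Finset.sum_congr rfl fun k _ => ?_
    rw [hp']; ring
  rw [← hZ, e1, e2, e5, Finset.sum_add_distrib, e3]
  simp_rw [mul_sub] at e4
  rw [Finset.sum_sub_distrib] at e4
  have e6 : 0 ≤ η / β := by positivity
  have e7 := mul_nonneg_of_nonpos_of_nonpos e4 (neg_nonpos.2 e6)
  refine le_of_sub_nonneg (le_of_le_of_eq e7 ?_)
  field_simp
  ring

lemma aux_mono_s17 (f f' : ℝ → ℝ) (h : ∀ t, 0 ≤ t → HasDerivAt f (f' t) t)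
    (h0 : ∀ t, 0 ≤ t → f' t ≤ 0) : ∀ s t, 0 ≤ s → s ≤ t → f t ≤ f s :=
  aux_antitone f (fun t ht => (h t ht).continuousAt.continuousWithinAt) fun t ht =>
    ⟨f, f' t, h t ht, h0 t ht, rfl, Eventually.of_forall fun _ => le_rfl⟩

/-- `f' ≤ -a f` and `f 0 ≤ 0` give `f ≤ 0`; strict version included. -/
lemma aux_gronwall (f f' : ℝ → ℝ) (a : ℝ) (h : ∀ t, 0 ≤ t → HasDerivAt f (f' t) t)
    (h0 : ∀ t, 0 ≤ t → f' t ≤ -a * f t) : ∀ t, 0 ≤ t → Real.exp (a * t) * f t ≤ f 0 := by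
  intro t ht
  have := aux_mono_s17 (fun t => Real.exp (a * t) * f t)
    (fun t => Real.exp (a * t) * (a * 1) * f t + Real.exp (a * t) * f' t)
    (fun t ht => (((hasDerivAt_id t).const_mul a).exp).mul (h t ht)) ?_ 0 t le_rfl ht
  · simpa using this
  · intro s hs
    have h1 := h0 s hs
    have h2 := Real.exp_pos (a * s)
    nlinarith

lemma aux_xlogx (x : ℝ) (hx : 0 < x) : -1 ≤ x * Real.log x := by
  have := Real.one_sub_inv_le_log_of_pos hx
  have h2 : x * (1 - x⁻¹) ≤ x * Real.log x := mul_le_mul_of_nonneg_left this hx.le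
  rw [mul_sub, mul_inv_cancel₀ hx.ne'] at h2
  linarith

lemma aux_logZ (n : ℕ) (β : ℝ) (τ : Fin n → ℝ) (l : Fin n) :
    -β * τ l ≤ Real.log (∑ l, Real.exp (-β * τ l)) := by
  rw [← Real.log_exp (-β * τ l)]
  refine Real.log_le_log (Real.exp_pos _) ?_
  exact Finset.single_le_sum (f := fun l => Real.exp (-β * τ l))
    (fun _ _ => (Real.exp_pos _).le) (Finset.mem_univ l)

/-- Coercivity of the storage function. -/
lemma aux_storage_lb (n : ℕ) (β η : ℝ) (hβ : 0 < β) (hη : 0 < η) (τ p : Fin n → ℝ)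
    (hp : ∀ k, 0 < p k) (hs : ∑ k, p k = 1) (k l : Fin n) :
    η * (p k * (τ k - τ l) - n / β) ≤ storageS n η β τ p := by
  unfold storageS
  refine mul_le_mul_of_nonneg_left ?_ hη.le
  set L := Real.log (∑ l, Real.exp (-β * τ l)) with hL
  have h1 : ∀ j, 0 ≤ τ j + (1 / β) * L := fun j => by
    have := aux_logZ n β τ j
    have h2 : (1 / β) * (-β * τ j) ≤ (1 / β) * L := by gcongr
    have h3 : (1 / β) * (-β * τ j) = - τ j := by field_simp
    linarith
  have h2 : ∑ j, p j * τ j + (1 / β) * L = ∑ j, p j * (τ j + (1 / β) * L) := by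
    simp_rw [mul_add]
    rw [Finset.sum_add_distrib, ← Finset.sum_mul, hs, one_mul]
  have h3 : p k * (τ k + (1 / β) * L) ≤ ∑ j, p j * (τ j + (1 / β) * L) :=
    Finset.single_le_sum (f := fun j => p j * (τ j + (1 / β) * L))
      (fun j _ => mul_nonneg (hp j).le (h1 j)) (Finset.mem_univ k)
  have h4 : p k * (τ k - τ l) ≤ p k * (τ k + (1 / β) * L) := by
    refine mul_le_mul_of_nonneg_left ?_ (hp k).le
    linarith [h1 l]
  have h5 : -(n : ℝ) ≤ ∑ j, p j * Real.log (p j) := by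
    have : ∑ _j : Fin n, (-1 : ℝ) ≤ ∑ j, p j * Real.log (p j) :=
      Finset.sum_le_sum fun j _ => aux_xlogx _ (hp j)
    simpa using this
  have h6 : (1 / β) * -(n : ℝ) ≤ (1 / β) * ∑ j, p j * Real.log (p j) := by gcongr
  have h7 : (1 / β) * -(n : ℝ) = - (n / β) := by ring
  linarith

set_option maxHeartbeats 4000000

/-- (Theorem 2: convergence of Model 2 with the saturated PI
mechanism.) For the closed-loop system `π̇ = η (Q(W(π) T) - π)`,
`μ̇_k = min{ρ(π_k - π*_k), -α μ_k}`, `μ_k(0) ≤ 0`,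
`T = T̄·1 + μ + κ(π - π*)` with `π(0) ∈ int(S)`, `α > 1/(2κ)` and bias
functions satisfying Assumption 2: if `κ > 2 v^H (T̄ + κ)/w^L` (note the
mechanism guarantees `T_k(t) ≤ T_max := T̄ + κ`), then `π(t) → π*`. -/
theorem stmt17 (n : ℕ) (hn : 1 ≤ n) (β η ρ κ α Tbar : ℝ)
    (hβ : 0 < β) (hη : 0 < η) (hρ : 0 < ρ) (hκ : 0 < κ)
    (hα : 1 / (2 * κ) < α) (hTbar : 0 < Tbar)
    (πs : Fin n → ℝ) (hπs : πs ∈ simplexInt n)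
    (w w' : Fin n → ℝ → ℝ) (wL wH vL vH : ℝ)
    (hwL : 0 < wL) (hwLH : wL ≤ wH) (hvL : 0 < vL) (hvLH : vL ≤ vH)
    (hw_cont : ∀ k, ContinuousOn (w k) (Set.Icc 0 1))
    (hw_deriv : ∀ k, ∀ q ∈ Set.Ioo (0 : ℝ) 1, HasDerivAt (w k) (w' k q) q)
    (hw'_cont : ∀ k, ContinuousOn (w' k) (Set.Ioo 0 1))
    (hw_anti : ∀ k, StrictAntiOn (w k) (Set.Icc 0 1))
    (hw_bdd : ∀ k, ∀ q ∈ Set.Icc (0 : ℝ) 1, wL ≤ w k q ∧ w k q ≤ wH)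
    (hw'_bdd : ∀ k, ∀ q ∈ Set.Ioo (0 : ℝ) 1, -vH ≤ w' k q ∧ w' k q ≤ -vL)
    (π μ T : ℝ → Fin n → ℝ)
    (hinit : π 0 ∈ simplexInt n)
    (hμ0 : ∀ k, μ 0 k ≤ 0)
    (hT : ∀ t, ∀ k, T t k = Tbar + μ t k + κ * (π t k - πs k))
    (hμd : ∀ t, 0 ≤ t →
      HasDerivAt μ (fun k => min (ρ * (π t k - πs k)) (-α * μ t k)) t)
    (hπd : ∀ t, 0 ≤ t →
      HasDerivAt π
        (fun k => η * (logitQ n β (fun l => w l (π t l) * T t l) k - π t k)) t)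
    (hgain : 2 * vH * (Tbar + κ) / wL < κ) :
    Filter.Tendsto π Filter.atTop (nhds πs) := by
  obtain ⟨hs01, hssum⟩ := hπs
  obtain ⟨hi01, hisum⟩ := hinit
  have hα0 : 0 < α := lt_trans (by positivity) hα
  have hne : Nonempty (Fin n) := ⟨⟨0, hn⟩⟩
  have hvH : 0 < vH := lt_of_lt_of_le hvL hvLH
  set τ : ℝ → Fin n → ℝ := fun t l => w l (π t l) * T t l with hτdef
  -- coordinate derivatives
  have hπk : ∀ t, 0 ≤ t → ∀ k, HasDerivAt (fun z => π z k)
      (η * (logitQ n β (τ t) k - π t k)) t := fun t ht k => (hasDerivAt_pi.1 (hπd t ht)) k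
  have hμk : ∀ t, 0 ≤ t → ∀ k, HasDerivAt (fun z => μ z k)
      (min (ρ * (π t k - πs k)) (-α * μ t k)) t := fun t ht k => (hasDerivAt_pi.1 (hμd t ht)) k
  have hZ : ∀ t, 0 < ∑ l, Real.exp (-β * τ t l) := fun t =>
    Finset.sum_pos (fun _ _ => Real.exp_pos _) Finset.univ_nonempty
  have hQpos : ∀ t k, 0 < logitQ n β (τ t) k := fun t k =>
    div_pos (Real.exp_pos _) (hZ t)
  have hQsum : ∀ t, ∑ k, logitQ n β (τ t) k = 1 := fun t => by
    unfold logitQ; rw [← Finset.sum_div]; exact div_self (hZ t).ne'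
  have hQle : ∀ t k, logitQ n β (τ t) k ≤ 1 := fun t k => by
    rw [← hQsum t]
    exact Finset.single_le_sum (f := fun k => logitQ n β (τ t) k)
      (fun j _ => (hQpos t j).le) (Finset.mem_univ k)
  -- invariance
  have hpos : ∀ t, 0 ≤ t → ∀ k, 0 < π t k := fun t ht k => by
    have h1 := aux_gronwall (fun z => -π z k) (fun t => -(η * (logitQ n β (τ t) k - π t k))) η
      (fun t ht => (hπk t ht k).neg) (fun t _ => by
        have := mul_pos hη (hQpos t k)
        nlinarith) t ht
    have h2 := (hi01 k).1
    by_contra hcon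
    have h3 := mul_nonneg (Real.exp_pos (η * t)).le (neg_nonneg.2 (not_lt.1 hcon))
    linarith
  have hlt1 : ∀ t, 0 ≤ t → ∀ k, π t k < 1 := fun t ht k => by
    have h1 := aux_gronwall (fun z => π z k - 1) (fun t => (η * (logitQ n β (τ t) k - π t k))) η
      (fun t ht => (hπk t ht k).sub_const 1) (fun t _ => by
        have := mul_nonneg hη.le (sub_nonneg.2 (hQle t k))
        nlinarith) t ht
    have h2 := (hi01 k).2
    by_contra hcon
    have h3 := mul_nonneg (Real.exp_pos (η * t)).le (sub_nonneg.2 (not_lt.1 hcon))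
    linarith
  have hsumd : ∀ t, 0 ≤ t → HasDerivAt (fun z => ∑ k, π z k) (η * (1 - ∑ k, π t k)) t := by
    intro t ht
    have := HasDerivAt.fun_sum (u := Finset.univ) fun k _ => hπk t ht k
    rw [← Finset.mul_sum, Finset.sum_sub_distrib, hQsum] at this
    exact this
  have hsum : ∀ t, 0 ≤ t → ∑ k, π t k = 1 := fun t ht => by
    have h1 := aux_gronwall (fun z => ∑ k, π z k - 1) _ η
      (fun t ht => (hsumd t ht).sub_const 1) (fun t _ => by nlinarith) t ht
    have h2 := aux_gronwall (fun z => -(∑ k, π z k - 1)) _ η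
      (fun t ht => ((hsumd t ht).sub_const 1).neg) (fun t _ => by nlinarith) t ht
    simp only [hisum, sub_self, neg_zero] at h1 h2
    have h3 := Real.exp_pos (η * t)
    have h4 : Real.exp (η * t) * (∑ k, π t k - 1) = 0 := by linarith
    rcases mul_eq_zero.1 h4 with h | h
    · exact absurd h h3.ne'
    · linarith
  have hμ : ∀ t, 0 ≤ t → ∀ k, μ t k ≤ 0 := fun t ht k => by
    have h1 := aux_gronwall (fun z => μ z k) _ α
      (fun t ht => (hμk t ht k)) (fun t _ => min_le_right _ _) t ht
    have h2 := hμ0 k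
    by_contra hcon
    have h3 := mul_pos (Real.exp_pos (α * t)) (not_le.1 hcon)
    linarith
  have hTmax : ∀ t, 0 ≤ t → ∀ k, T t k ≤ Tbar + κ := fun t ht k => by
    have h1 := hμ t ht k
    have h2 := hlt1 t ht k
    have h3 := (hs01 k).1
    rw [hT]; nlinarith
  set c := κ * wL - vH * (Tbar + κ) with hc
  have hcpos : 0 < c := by
    rw [div_lt_iff₀ hwL] at hgain
    have : 0 < vH * (Tbar + κ) := by positivity
    rw [hc]; nlinarith
  -- extended w
  set wE : Fin n → ℝ → ℝ := fun k => Set.IccExtend (zero_le_one (α := ℝ)) ((Set.Icc 0 1).domRestrict (w k))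
    with hwE
  have hwEc : ∀ k, Continuous (wE k) := fun k =>
    (continuousOn_iff_continuous_domRestrict.1 (hw_cont k)).Icc_extend'
  have hwEeq : ∀ k, ∀ q, 0 < q → q < 1 → wE k q = w k q := fun k q h0 h1 => by
    simp only [hwE]
    rw [Set.IccExtend_of_mem _ _ (⟨h0.le, h1.le⟩ : q ∈ Set.Icc (0 : ℝ) 1)]
    rfl
  have hwEb : ∀ k q, 0 ≤ wE k q ∧ wE k q ≤ wH := fun k q => by
    have := hw_bdd k (Set.projIcc 0 1 zero_le_one q) (Subtype.coe_prop _)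
    exact ⟨hwL.le.trans this.1, this.2⟩
  -- derivative of τ
  set τ' : ℝ → Fin n → ℝ := fun t k =>
    w' k (π t k) * (η * (logitQ n β (τ t) k - π t k)) * T t k +
    w k (π t k) * (min (ρ * (π t k - πs k)) (-α * μ t k)
      + κ * (η * (logitQ n β (τ t) k - π t k))) with hτ'
  have hτd : ∀ t, 0 ≤ t → ∀ k, HasDerivAt (fun z => τ z k) (τ' t k) t := fun t ht k => by
    have h1 : HasDerivAt (fun z => w k (π z k))
        (w' k (π t k) * (η * (logitQ n β (τ t) k - π t k))) t :=
      (hw_deriv k (π t k) ⟨hpos t ht k, hlt1 t ht k⟩).comp t (hπk t ht k)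
    have h2 : HasDerivAt (fun z => T z k) (min (ρ * (π t k - πs k)) (-α * μ t k)
      + κ * (η * (logitQ n β (τ t) k - π t k))) t := by
      have : (fun z => T z k) = fun z => (Tbar + μ z k) + κ * (π z k - πs k) := by
        funext z; exact hT z k
      rw [this]
      exact ((hμk t ht k).const_add Tbar).add (((hπk t ht k).sub_const (πs k)).const_mul κ)
    exact h1.mul h2
  -- Lyapunov function
  set V : ℝ → ℝ := fun t => storageS n η β (τ t) (π t)
    + ∑ k, auxU (wE k) ρ α (πs k) (π t k) (μ t k) with hV
  have hπc : ∀ k, ContinuousOn (fun t => π t k) (Set.Ici 0) := fun k t ht =>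
    (hπk t ht k).continuousAt.continuousWithinAt
  have hμc : ∀ k, ContinuousOn (fun t => μ t k) (Set.Ici 0) := fun k t ht =>
    (hμk t ht k).continuousAt.continuousWithinAt
  have hSd : ∀ t, 0 ≤ t → ∃ D, HasDerivAt (fun z => storageS n η β (τ z) (π z)) D t ∧
      D ≤ - ∑ k, (η * (logitQ n β (τ t) k - π t k)) * τ' t k := fun t ht =>
    aux_storage n hn β η t hβ hη τ π (τ' t) _ (hτd t ht) (hπk t ht) (fun _ => rfl)
      (hpos t ht) (hsum t ht)
  have hVc : ContinuousOn V (Set.Ici 0) := by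
    refine ContinuousOn.add (fun t ht => ?_) (continuousOn_finsetSum _ fun k _ => ?_)
    · obtain ⟨D, hD, _⟩ := hSd t ht
      exact hD.continuousAt.continuousWithinAt
    · exact auxU_cont (wE k) (hwEc k) ρ α (πs k) _ _ _ (hπc k) (hμc k)
  have hmain : ∀ (j : Fin n) (a : ℝ), ∀ s t, 0 ≤ s → s ≤ t →
      V t + 2 * a * c * π t j - a ^ 2 * c * t ≤ V s + 2 * a * c * π s j - a ^ 2 * c * s := by
    intro j a
    refine aux_antitone (fun t => V t + 2 * a * c * π t j - a ^ 2 * c * t) ?_ ?_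
    · exact (hVc.add ((hπc j).const_mul _)).sub (by fun_prop)
    intro t ht
    obtain ⟨D, hD, hDle⟩ := hSd t ht
    have hU := fun k => auxU_major (wE k) (hwEc k) wH (hwEb k) ρ α (πs k) _ t
      (fun z => π z k) (fun z => μ z k) hα0 hρ (hπk t ht k) (hμk t ht k)
      (fun z hz => hμ z (ht.trans hz) k)
    choose H hHd hHt hHle using hU
    have hd := (((hD.add (HasDerivAt.fun_sum (u := Finset.univ) fun k _ => hHd k)).add
      ((hπk t ht j).const_mul (2 * a * c))).sub ((hasDerivAt_id t).const_mul (a ^ 2 * c)))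
    refine ⟨_, _, hd, ?_, ?_, ?_⟩
    · set x : Fin n → ℝ := fun k => η * (logitQ n β (τ t) k - π t k) with hx
      have h1 : ∀ k, wE k (π t k) * min (ρ * (π t k - πs k)) (-α * μ t k) * x k
          - x k * τ' t k ≤ - c * x k ^ 2 := fun k => by
        rw [hwEeq k _ (hpos t ht k) (hlt1 t ht k)]
        have e : w k (π t k) * min (ρ * (π t k - πs k)) (-α * μ t k) * x k - x k * τ' t k
            = - (κ * w k (π t k) + w' k (π t k) * T t k) * x k ^ 2 := by
          simp only [hτ', hx]; ring
        rw [e]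
        have b1 := hw_bdd k (π t k) ⟨(hpos t ht k).le, (hlt1 t ht k).le⟩
        have b2 := hw'_bdd k (π t k) ⟨hpos t ht k, hlt1 t ht k⟩
        have b3 : -(vH * (Tbar + κ)) ≤ w' k (π t k) * T t k := by
          have b4 := hTmax t ht k
          rcases le_total 0 (T t k) with h | h
          · have i1 := mul_le_mul_of_nonneg_right b2.1 h
            have i2 := mul_le_mul_of_nonneg_left b4 hvH.le
            linarith
          · have i1 := mul_nonneg_of_nonpos_of_nonpos (show w' k (π t k) ≤ 0 by linarith) h
            have : 0 < vH * (Tbar + κ) := by positivity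
            linarith
        have b5 : κ * wL ≤ κ * w k (π t k) := mul_le_mul_of_nonneg_left b1.1 hκ.le
        refine mul_le_mul_of_nonneg_right ?_ (sq_nonneg _)
        rw [hc]; linarith
      have h2 : ∑ k, (wE k (π t k) * min (ρ * (π t k - πs k)) (-α * μ t k) * x k
          - x k * τ' t k) ≤ - c * x j ^ 2 := by
        refine (Finset.sum_le_sum fun k _ => h1 k).trans ?_
        rw [← Finset.mul_sum]
        have := Finset.single_le_sum (f := fun k => x k ^ 2) (fun _ _ => sq_nonneg _)
          (Finset.mem_univ j)
        have := mul_le_mul_of_nonneg_left this hcpos.le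
        linarith
      rw [Finset.sum_sub_distrib] at h2
      have h3 : 0 ≤ c * (x j - a) ^ 2 := by positivity
      have h4 : x j = η * (logitQ n β (τ t) j - π t j) := rfl
      rw [← h4]
      nlinarith
    · simp [hV, hHt]
    · have := (Filter.eventually_all (ι := Fin n)).2 hHle
      filter_upwards [this] with z hz
      have h1 := Finset.sum_le_sum (s := Finset.univ) fun k _ => hz k
      simp only [hV, Pi.add_apply, Pi.sub_apply, id]
      linarith
  have hVanti : ∀ s t, 0 ≤ s → s ≤ t → V t ≤ V s := fun s t hs hst => by
    have := hmain ⟨0, hn⟩ 0 s t hs hst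
    simpa using this
  have hUlb : ∀ t, 0 ≤ t → -(n * (wH * ρ)) ≤ ∑ k, auxU (wE k) ρ α (πs k) (π t k) (μ t k) := by
    intro t ht
    have : ∑ _k : Fin n, -(wH * ρ) ≤ ∑ k, auxU (wE k) ρ α (πs k) (π t k) (μ t k) :=
      Finset.sum_le_sum fun k _ => (abs_le.1 (auxU_bd (wE k) wH (hwEb k) ρ α (πs k) (π t k)
        (μ t k) hα0 hρ (hμ t ht k) (hs01 k) ⟨hpos t ht k, hlt1 t ht k⟩)).1
    simpa using this
  have hVlb : ∀ t, 0 ≤ t → ∀ k l, η * (π t k * (τ t k - τ t l) - n / β) - n * (wH * ρ) ≤ V t := by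
    intro t ht k l
    have h1 := aux_storage_lb n β η hβ hη (τ t) (π t) (hpos t ht) (hsum t ht) k l
    have h2 := hUlb t ht
    simp only [hV]; linarith
  -- μ is bounded below
  have hwH : 0 < wH := lt_of_lt_of_le hwL hwLH
  have hsat : ∀ k, ∃ C : ℝ, ∀ t, 0 ≤ t → -α * μ t k < ρ * (π t k - πs k) → -C ≤ ∑ l, μ t l := by
    intro k
    set C0 := (V 0 + n * (wH * ρ)) / η + n / β with hC0
    set E := |C0| / πs k + wH * (ρ / α + κ) with hE
    have hE0 : 0 ≤ E := by
      have := (hs01 k).1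
      positivity
    refine ⟨n * (E / wL + Tbar + κ), fun t ht hst => ?_⟩
    have hm := hμ t ht k
    have hek : 0 < π t k - πs k := by
      have : 0 < ρ * (π t k - πs k) := lt_of_le_of_lt (by nlinarith) hst
      exact (pos_iff_pos_of_mul_pos this).1 hρ
    have hp1 := hlt1 t ht k
    have hps := hs01 k
    have hμlb : -(ρ / α) ≤ μ t k := by
      rw [neg_le, ← sub_nonneg]
      have : 0 ≤ (ρ + α * μ t k) / α := by
        refine div_nonneg ?_ hα0.le
        nlinarith
      have e : (ρ + α * μ t k) / α = ρ / α - -μ t k := by field_simp; ring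
      linarith
    have hTk : -(ρ / α + κ) ≤ T t k := by rw [hT]; nlinarith
    have hρα : 0 < ρ / α + κ := by positivity
    have hτk : -(wH * (ρ / α + κ)) ≤ τ t k := by
      have b1 := hw_bdd k (π t k) ⟨(hpos t ht k).le, (hlt1 t ht k).le⟩
      have i1 := mul_le_mul_of_nonneg_left hTk (hwL.le.trans b1.1)
      have i2 := mul_le_mul_of_nonneg_right b1.2 hρα.le
      simp only [hτdef]; linarith
    have hμl : ∀ l, -(E / wL + Tbar + κ) ≤ μ t l := by
      intro l
      have h1 := (hVlb t ht k l).trans (hVanti 0 t le_rfl ht)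
      have h2 : π t k * (τ t k - τ t l) ≤ C0 := by
        have : π t k * (τ t k - τ t l) - n / β ≤ (V 0 + n * (wH * ρ)) / η := by
          rw [le_div_iff₀ hη]; linarith
        linarith
      have h3 : τ t k - τ t l ≤ |C0| / πs k := by
        rw [le_div_iff₀ hps.1]
        rcases le_total (τ t k - τ t l) 0 with h | h
        · have := mul_nonpos_of_nonpos_of_nonneg h hps.1.le
          exact this.trans (abs_nonneg _)
        · have i1 := mul_le_mul_of_nonneg_left (show πs k ≤ π t k by linarith) h
          have := le_abs_self C0
          linarith
      have h4 : -E ≤ τ t l := by rw [hE]; linarith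
      have h5 : -(E / wL) ≤ T t l := by
        rcases le_total 0 (T t l) with h | h
        · have : 0 ≤ E / wL := by positivity
          linarith
        · have b1 := hw_bdd l (π t l) ⟨(hpos t ht l).le, (hlt1 t ht l).le⟩
          have i1 := mul_le_mul_of_nonpos_right b1.1 h
          rw [neg_le, le_div_iff₀ hwL]
          simp only [hτdef] at h4
          linarith
      have h6 := hT t l
      have h7 := hlt1 t ht l
      have h8 := (hs01 l).1
      have : κ * (π t l - πs l) ≤ κ * 1 := mul_le_mul_of_nonneg_left (by linarith) hκ.le
      linarith
    have : ∑ _l : Fin n, -(E / wL + Tbar + κ) ≤ ∑ l, μ t l := Finset.sum_le_sum fun l _ => hμl l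
    rw [Finset.sum_const, Finset.card_univ, Fintype.card_fin, nsmul_eq_mul] at this
    linarith
  choose Cs hCs using hsat
  obtain ⟨C4, hC4⟩ := (Set.finite_range Cs).bddAbove
  have hC4' : ∀ k, Cs k ≤ C4 := fun k => hC4 (Set.mem_range_self k)
  set B := max (-∑ k, μ 0 k) C4 + 1 with hB
  have hMd : ∀ t, 0 ≤ t → HasDerivAt (fun z => -∑ k, μ z k)
      (-∑ k, min (ρ * (π t k - πs k)) (-α * μ t k)) t := fun t ht =>
    (HasDerivAt.fun_sum fun k _ => hμk t ht k).neg
  have hMb : ∀ t, 0 ≤ t → -∑ k, μ t k ≤ B := by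
    intro t ht
    refine le_of_forall_pos_le_add fun δ hδ => ?_
    have hδ' : 0 < δ / (t + 1) := by positivity
    have := image_le_of_deriv_right_lt_deriv_boundary' (f := fun z => -∑ k, μ z k)
      (f' := fun t => -∑ k, min (ρ * (π t k - πs k)) (-α * μ t k)) (a := 0) (b := t)
      (fun z hz => (hMd z hz.1).continuousAt.continuousWithinAt)
      (fun z hz => (hMd z hz.1).hasDerivWithinAt)
      (B := fun z => B + δ / (t + 1) * z) (B' := fun _ => δ / (t + 1) * 1) ?_ (by fun_prop)
      (fun z _ => (((hasDerivAt_id z).const_mul _).const_add _).hasDerivWithinAt) ?_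
      (x := t) ⟨ht, le_rfl⟩
    · refine this.trans ?_
      have : δ / (t + 1) * t ≤ δ := by
        rw [div_mul_eq_mul_div, div_le_iff₀ (by linarith)]; nlinarith
      linarith
    · simp only [mul_zero, add_zero, hB]
      linarith [le_max_left (-∑ k, μ 0 k) C4]
    · intro z hz heq
      have hz0 := hz.1
      have hlt : C4 < -∑ k, μ z k := by
        rw [heq, hB]
        have := le_max_right (-∑ k, μ 0 k) C4
        have := mul_nonneg hδ'.le hz0
        linarith
      have huns : ∀ k, ρ * (π z k - πs k) ≤ -α * μ z k := by
        intro k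
        by_contra hcon
        have := hCs k z hz0 (not_le.1 hcon)
        linarith [hC4' k]
      have : ∑ k, min (ρ * (π z k - πs k)) (-α * μ z k) = 0 := by
        rw [Finset.sum_congr rfl fun k _ => min_eq_left (huns k), ← Finset.mul_sum,
          Finset.sum_sub_distrib, hsum z hz0, hssum]
        simp
      simp only [this]
      simpa using hδ'
  have hμlb : ∀ t, 0 ≤ t → ∀ k, -B ≤ μ t k := by
    intro t ht k
    have h1 := hMb t ht
    have h2 := Finset.single_le_sum (f := fun k => -μ t k)
      (fun j _ => neg_nonneg.2 (hμ t ht j)) (Finset.mem_univ k)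
    rw [Finset.sum_neg_distrib] at h2
    linarith
  -- V converges
  have hVcauchy : ∀ ε > 0, ∃ t0, 0 ≤ t0 ∧ ∀ s t, t0 ≤ s → s ≤ t → V s - V t < ε := by
    intro ε hε
    have hbdd : BddBelow (V '' Set.Ici 0) := by
      refine ⟨η * (0 - n / β) - n * (wH * ρ), ?_⟩
      rintro _ ⟨t, ht, rfl⟩
      have := hVlb t ht ⟨0, hn⟩ ⟨0, hn⟩
      simpa using this
    obtain ⟨_, ⟨t0, ht0, rfl⟩, hlt⟩ := exists_lt_of_csInf_lt
      (s := V '' Set.Ici 0) ⟨V 0, 0, Set.self_mem_Ici, rfl⟩ (lt_add_of_pos_right (sInf (V '' Set.Ici 0)) hε)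
    refine ⟨t0, ht0, fun s t hs hst => ?_⟩
    have h1 := hVanti t0 s ht0 hs
    have h2 := csInf_le hbdd ⟨t, (le_trans ht0 (hs.trans hst)), rfl⟩
    linarith
  -- one-sided estimate
  have hone : ∀ k, ∀ ε > 0, ∃ t0, 0 ≤ t0 ∧ ∀ t, t0 ≤ t → -ε < π t k - πs k := by
    intro k ε hε
    have hB0 : 0 ≤ B := by
      have := hμlb 0 le_rfl k
      linarith [hμ 0 le_rfl k]
    set h := 2 * (B + 1) / (ρ * ε) with hh
    have hhpos : 0 < h := by positivity
    have hhe : ρ * (ε / 2) * h = B + 1 := by rw [hh]; field_simp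
    set a := ε / (2 * h) with ha
    have hapos : 0 < a := by positivity
    have hah : a * h = ε / 2 := by rw [ha]; field_simp
    obtain ⟨t0, ht0, hV0⟩ := hVcauchy (a * c * (ε / 2)) (by positivity)
    refine ⟨t0, ht0, fun t ht => ?_⟩
    by_contra hcon
    rw [not_lt] at hcon
    have ht' : 0 ≤ t := ht0.trans ht
    have hstay : ∀ z, t ≤ z → z ≤ t + h → π z k - πs k ≤ -(ε / 2) := by
      intro z hz1 hz2
      have h1 := hmain k a t z ht' hz1
      have h2 := hV0 t z ht hz1
      have h3 : a ^ 2 * c * (z - t) ≤ a * c * (ε / 2) := by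
        have : a ^ 2 * c * (z - t) ≤ a ^ 2 * c * h :=
          mul_le_mul_of_nonneg_left (by linarith) (by positivity)
        have e : a ^ 2 * c * h = a * c * (a * h) := by ring
        rw [e, hah] at this
        exact this
      have h4 : (a * c) * (2 * (π z k - π t k)) < (a * c) * ε := by linarith
      have h5 := lt_of_mul_lt_mul_left h4 (by positivity)
      linarith
    have hdec := image_le_of_deriv_right_le_deriv_boundary (f := fun z => μ z k)
      (f' := fun t => min (ρ * (π t k - πs k)) (-α * μ t k)) (a := t) (b := t + h)
      (fun z hz => (hμk z (ht'.trans hz.1) k).continuousAt.continuousWithinAt)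
      (fun z hz => (hμk z (ht'.trans hz.1) k).hasDerivWithinAt)
      (B := fun z => μ t k + (-(ρ * (ε / 2))) * (z - t)) (B' := fun _ => (-(ρ * (ε / 2))) * 1)
      (by simp) (by fun_prop)
      (fun z _ => ((((hasDerivAt_id z).sub_const t).const_mul _).const_add _).hasDerivWithinAt)
      (fun z hz => by
        refine (min_le_left _ _).trans ?_
        have := mul_le_mul_of_nonneg_left (hstay z hz.1 hz.2.le) hρ.le
        linarith)
      (x := t + h) ⟨by linarith, le_rfl⟩
    have h1 := hμlb (t + h) (by linarith) k
    have h2 := hμ t ht' k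
    simp only [add_sub_cancel_left] at hdec
    linarith
  -- conclusion
  rw [tendsto_pi_nhds]
  intro k
  rw [Metric.tendsto_atTop]
  intro ε hε
  have hnp : (0 : ℝ) < n := by exact_mod_cast hn
  have hεn : 0 < ε / (2 * n) := by positivity
  have hex : ∀ l, ∃ t0, 0 ≤ t0 ∧ ∀ t, t0 ≤ t → -(ε / (2 * n)) < π t l - πs l :=
    fun l => hone l _ hεn
  choose ts hts0 hts using hex
  obtain ⟨t1, ht1⟩ := (Set.finite_range ts).bddAbove
  refine ⟨max t1 0, fun t ht => ?_⟩
  have ht0 : 0 ≤ t := (le_max_right _ _).trans ht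
  have hall : ∀ l, -(ε / (2 * n)) < π t l - πs l := fun l =>
    hts l t ((ht1 (Set.mem_range_self l)).trans ((le_max_left _ _).trans ht))
  have hsum0 : ∑ l, (π t l - πs l + ε / (2 * n)) = ε / 2 := by
    rw [Finset.sum_add_distrib, Finset.sum_sub_distrib, hsum t ht0, hssum]
    simp
    field_simp
  have hle := Finset.single_le_sum (f := fun l => π t l - πs l + ε / (2 * n))
    (fun l _ => by linarith [hall l]) (Finset.mem_univ k)
  rw [hsum0] at hle
  have hsmall : ε / (2 * n) ≤ ε / 2 := by
    have : (1 : ℝ) ≤ n := by exact_mod_cast hn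
    gcongr
    linarith
  rw [Real.dist_eq, abs_lt]
  constructor
  · linarith [hall k]
  · linarith
end
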